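/- arXiv:2512.23285 — 4 statements merged into one kernel-verified Lean document; each statement's English description precedes it below -/
import Mathlib

section
/- The family of functions f_Q^{m,ℓ}, indexed by all triples (m, Q, ℓ) with 0 ≤ m ≤ ⌊n/2⌋, Q a standard Young tableau of shape (n−m,m), and 0 ≤ ℓ ≤ n−2m, is pairwise orthogonal with respect to ⟨·,·⟩_π (i.e., ⟨f_P^{m₁,ℓ₁}, f_Q^{m₂,ℓ₂}⟩_π = 0 whenever (m₁,P,ℓ₁) ≠ (m₂,Q,ℓ₂)), and each f_Q^{m,ℓ} is nonzero; consequently this family is an orthogonal basis of the 2^n-dimensional space of functions C_2^n → ℝ. -/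
open Finset

attribute [local instance] Classical.propDecidable

/-- Stationary distribution of the binary Burnside process. -/
noncomputable def piDist (n : ℕ) (U : Finset ℕ) : ℝ :=
  1 / ((n + 1) * (n.choose U.card))

/-- Binary Burnside transition matrix entry. -/
noncomputable def Kmat (n : ℕ) (x y : Finset ℕ) : ℝ :=
  (((2 * (n - (x ∪ y).card)).choose (n - (x ∪ y).card) : ℝ) *
      ((2 * ((y \ x).card)).choose ((y \ x).card)) *
      ((2 * ((x \ y).card)).choose ((x \ y).card)) *
      ((2 * ((x ∩ y).card)).choose ((x ∩ y).card))) /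
    (4 ^ n * (((n - (x ∪ y).card) + (y \ x).card).choose (n - (x ∪ y).card)) *
      (((x \ y).card + (x ∩ y).card).choose ((x \ y).card)))

/-- Action of K_n on functions. -/
noncomputable def Kop (n : ℕ) (f : Finset ℕ → ℝ) : Finset ℕ → ℝ :=
  fun x => ∑ y ∈ (Finset.Icc 1 n).powerset, Kmat n x y * f y

/-- s-step transition probabilities. -/
noncomputable def Kpow (n : ℕ) : ℕ → Finset ℕ → Finset ℕ → ℝ
  | 0 => fun x y => if x = y then 1 else 0
  | s + 1 => fun x y => ∑ z ∈ (Finset.Icc 1 n).powerset, Kmat n x z * Kpow n s z y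

/-- Chi-square distance to stationarity after s steps, started at x. -/
noncomputable def chiSq (n s : ℕ) (x : Finset ℕ) : ℝ :=
  ∑ y ∈ (Finset.Icc 1 n).powerset, (Kpow n s x y - piDist n y) ^ 2 / piDist n y

/-- Eigenvalues. -/
noncomputable def betaEV (k : ℕ) : ℝ := (((2 * k).choose k : ℝ)) ^ 2 / 16 ^ k

/-- The eigenvectors f_S of Diaconis–Lin–Ram. -/
noncomputable def fSvec (S : Finset ℕ) : Finset ℕ → ℝ :=
  fun U => (-1 : ℝ) ^ ((S ∩ U).card) * (S.card.choose ((S ∩ U).card))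

/-- Inner product with respect to π. -/
noncomputable def innerPi (n : ℕ) (f g : Finset ℕ → ℝ) : ℝ :=
  ∑ U ∈ (Finset.Icc 1 n).powerset, f U * g U * piDist n U

/-- The scalars T_{m,n}^{(ℓ)}(i). -/
noncomputable def Tcoef (n m ℓ i : ℕ) : ℝ :=
  ∑ j ∈ Finset.range (i + 1),
    if j ≤ ℓ then
      (-1 : ℝ) ^ (m + j) * ((2 * m + ℓ).choose (m + j)) * (i.choose j) *
        ((n - 2 * m - i).choose (ℓ - j))
    else 0

/-- The vector g_T^{m,i} associated to the column reading tableau. -/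
noncomputable def gT (n m i : ℕ) : Finset ℕ → ℝ := fun U =>
  if (∀ r ∈ Finset.Icc 1 m, ((2 * r - 1 ∈ U) ↔ ¬(2 * r ∈ U))) ∧
      (U ∩ Finset.Icc (2 * m + 1) n).card = i then
    (-1 : ℝ) ^ ((U ∩ (Finset.range m).image (fun r => 2 * r + 1)).card)
  else 0

/-- The vector f_T^{m,ℓ} associated to the column reading tableau. -/
noncomputable def fT (n m ℓ : ℕ) : Finset ℕ → ℝ :=
  fun U => ∑ i ∈ Finset.range (n - 2 * m + 1), Tcoef n m ℓ i * gT n m i U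

/-- Action of the adjacent transposition s_t (switching t and t+1) on functions. -/
noncomputable def sOp (t : ℕ) (f : Finset ℕ → ℝ) : Finset ℕ → ℝ :=
  fun U => f (U.image (Equiv.swap t (t + 1)))

/-- The factor s_t − 1/(t − 2r + 2) (r is the 1-indexed position in the second row). -/
noncomputable def tauFactor (r t : ℕ) (f : Finset ℕ → ℝ) : Finset ℕ → ℝ :=
  fun U => sOp t f U - ((t : ℝ) - 2 * r + 2)⁻¹ * f U

/-- Composition (s_{2r+k-1} − ⋯)⋯(s_{2r} − 1/2) of k successive factors. -/
noncomputable def tauComp (r : ℕ) : ℕ → (Finset ℕ → ℝ) → (Finset ℕ → ℝ)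
  | 0 => id
  | k + 1 => fun f => tauFactor r (2 * r + k) (tauComp r k f)

/-- τ_Q^{(r)} τ_Q^{(r+1)} ⋯ for the remaining second-row entries. -/
noncomputable def tauQAux : ℕ → List ℕ → (Finset ℕ → ℝ) → (Finset ℕ → ℝ)
  | _, [] => id
  | r, a :: rest => fun f => tauComp r (a - 2 * r) (tauQAux (r + 1) rest f)

/-- The operator τ_Q for a tableau Q encoded by its list of second-row entries. -/
noncomputable def tauQ (Q : List ℕ) : (Finset ℕ → ℝ) → (Finset ℕ → ℝ) := tauQAux 1 Q

/-- A standard Young tableau of shape (n − Q.length, Q.length), encoded by the strictly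
increasing list of second-row entries, each entry a_r satisfying 2r ≤ a_r ≤ n. -/
def IsSYT (n : ℕ) (Q : List ℕ) : Prop :=
  Q.Chain' (· < ·) ∧ (∀ x ∈ Q, x ≤ n) ∧ ∀ r < Q.length, 2 * (r + 1) ≤ Q.getD r 0

/-- The eigenvectors f_Q^{m,ℓ} (here m = Q.length). -/
noncomputable def fQvec (n : ℕ) (Q : List ℕ) (ℓ : ℕ) : Finset ℕ → ℝ :=
  tauQ Q (fT n Q.length ℓ)

/-- The orthogonal vectors g_Q^{m,i} (here m = Q.length). -/
noncomputable def gQvec (n : ℕ) (Q : List ℕ) (i : ℕ) : Finset ℕ → ℝ :=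
  tauQ Q (gT n Q.length i)

/-- The constant γ_Q. -/
noncomputable def gammaQ (Q : List ℕ) : ℝ :=
  ∏ r ∈ Finset.range Q.length, ∏ c ∈ Finset.Icc 2 (Q.getD r 0 - 2 * (r + 1) + 1),
    ((c : ℝ) ^ 2 - 1) / (c : ℝ) ^ 2

/-- The Murphy (Jucys–Murphy) operator M_r acting on functions. -/
noncomputable def murphy (r : ℕ) (f : Finset ℕ → ℝ) : Finset ℕ → ℝ :=
  fun U => ∑ i ∈ Finset.Icc 1 (r - 1), f (U.image (Equiv.swap i r))

/-- The state space as a finite type. -/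
noncomputable def transpEndo (n a b : ℕ) :
    Module.End ℝ ((↥((Finset.Icc 1 n).powerset)) → ℝ) where
  toFun f U := f (if h : U.1.image (Equiv.swap a b) ∈ (Finset.Icc 1 n).powerset
    then ⟨U.1.image (Equiv.swap a b), h⟩ else U)
  map_add' f g := rfl
  map_smul' c f := rfl

noncomputable def murphyEndo (n r : ℕ) :
    Module.End ℝ ((↥((Finset.Icc 1 n).powerset)) → ℝ) :=
  ∑ i ∈ Finset.Icc 1 (r - 1), transpEndo n i r

noncomputable def KEndo (n : ℕ) :
    Module.End ℝ ((↥((Finset.Icc 1 n).powerset)) → ℝ) where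
  toFun f x := ∑ y : ↥((Finset.Icc 1 n).powerset), Kmat n x.1 y.1 * f y
  map_add' f g := by funext x; simp [mul_add, Finset.sum_add_distrib]
  map_smul' c f := by funext x; simp [Finset.mul_sum, mul_left_comm]


/-! ### Orthogonality of the Hahn polynomials `Tcoef` -/

lemma sum_choose_mul_choose_sub (M p q : ℕ) :
    ∑ x ∈ range (M + 1), x.choose p * (M - x).choose q = (M + 1).choose (p + q + 1) := by
  induction q generalizing M with
  | zero =>
    simp only [Nat.choose_zero_right, mul_one, add_zero]
    induction M with
    | zero => simp [Nat.choose_succ_succ]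
    | succ M ih => rw [sum_range_succ, ih, Nat.choose_succ_succ (M + 1) p, add_comm]
  | succ q ihq =>
    induction M with
    | zero => simp [Nat.choose_eq_zero_of_lt (show 1 < p + (q + 1) + 1 by omega)]
    | succ M ih =>
      rw [sum_range_succ]
      have : ∀ x ∈ range (M + 1), x.choose p * (M + 1 - x).choose (q + 1) =
          x.choose p * (M - x).choose q + x.choose p * (M - x).choose (q + 1) := by
        intro x hx
        have hx' : x ≤ M := Nat.lt_succ_iff.mp (mem_range.mp hx)
        rw [Nat.succ_sub hx', Nat.choose_succ_succ, mul_add]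
      rw [sum_congr rfl this, sum_add_distrib, ihq, ih, Nat.sub_self, Nat.choose_zero_succ,
        mul_zero, add_zero, Nat.choose_succ_succ (M + 1) (p + (q + 1))]
      rfl

lemma ascFactorial_mul_choose (n p k : ℕ) :
    (n + 1).ascFactorial k * n.choose p = (n + k).choose (p + k) * (p + 1).ascFactorial k := by
  induction k with
  | zero => simp
  | succ k ih =>
    have h := Nat.add_one_mul_choose_eq (n + k) (p + k)
    rw [Nat.ascFactorial_succ, Nat.ascFactorial_succ, mul_assoc, ih, ← add_assoc, ← add_assoc]
    linear_combination (p + 1).ascFactorial k * h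

lemma sum_alternating_choose_mul_eval {P : Polynomial ℝ} {l : ℕ} (hP : P.natDegree < l) :
    ∑ j ∈ range (l + 1), (-1 : ℝ) ^ j * (l.choose j) * P.eval (j : ℝ) = 0 := by
  have h := congrFun (Polynomial.fwdDiff_iter_eq_zero_of_degree_lt hP) 0
  rw [fwdDiff_iter_eq_sum_shift] at h
  have h2 : ∑ j ∈ range (l + 1), (-1 : ℝ) ^ j * (l.choose j) * P.eval (j : ℝ) =
      (-1) ^ l * ∑ k ∈ range (l + 1), ((-1 : ℤ) ^ (l - k) * l.choose k) • P.eval (0 + k • (1 : ℝ)) := by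
    rw [mul_sum]
    refine sum_congr rfl fun j hj => ?_
    have hj' : j ≤ l := Nat.lt_succ_iff.mp (mem_range.mp hj)
    obtain ⟨d, rfl⟩ := Nat.exists_eq_add_of_le hj'
    have : (-1 : ℝ) ^ (j + d) * (-1) ^ d = (-1) ^ j := by
      rw [pow_add, mul_assoc, ← mul_pow]; simp
    simp only [zsmul_eq_mul, nsmul_eq_mul, mul_one, zero_add, Nat.add_sub_cancel_left]
    push_cast
    rw [← mul_assoc, ← mul_assoc, this]
  rw [h2, h]
  simp

/-- Unnormalised Hahn weight times the `j`-th summand of `Tcoef`. -/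
lemma choose_div_mul_choose (N m l i j : ℕ) (hi : i ≤ N) (hj : j ≤ l) :
    (N.choose i : ℝ) / ((N + 2 * m).choose (m + i)) *
        (((2 * m + l).choose (m + j)) * (i.choose j) * ((N - i).choose (l - j))) =
      (N.factorial * (2 * m + l).factorial / ((N + 2 * m).factorial * l.factorial) : ℝ) *
        ((l.choose j) * ((m + i).choose (m + j)) * ((N - i + m).choose (m + (l - j)))) := by
  obtain ⟨e, rfl⟩ := Nat.exists_eq_add_of_le hi
  obtain ⟨d, rfl⟩ := Nat.exists_eq_add_of_le hj
  simp only [Nat.add_sub_cancel_left]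
  by_cases hij : j ≤ i
  swap
  · rw [Nat.choose_eq_zero_of_lt (not_le.mp hij), Nat.choose_eq_zero_of_lt (by omega : m + i < m + j)]
    simp
  by_cases hde : d ≤ e
  swap
  · rw [Nat.choose_eq_zero_of_lt (not_le.mp hde), Nat.choose_eq_zero_of_lt (by omega : e + m < m + d)]
    simp
  obtain ⟨a, rfl⟩ := Nat.exists_eq_add_of_le hij
  obtain ⟨b, rfl⟩ := Nat.exists_eq_add_of_le hde
  have e1 : j + a + (d + b) + 2 * m = (m + (j + a)) + (m + (d + b)) := by ring
  have e2 : 2 * m + (j + d) = (m + j) + (m + d) := by ring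
  have e3 : m + (j + a) = (m + j) + a := by ring
  have e4 : d + b + m = (m + d) + b := by ring
  rw [Nat.cast_add_choose ℝ (a := j + a), e1, e2, Nat.cast_add_choose ℝ (a := m + (j + a)),
    Nat.cast_add_choose ℝ (a := m + j) (b := m + d), Nat.cast_add_choose ℝ (a := j) (b := a),
    Nat.cast_add_choose ℝ (a := d) (b := b), Nat.cast_add_choose ℝ (a := j) (b := d),
    e3, Nat.cast_add_choose ℝ (a := m + j) (b := a), e4,
    Nat.cast_add_choose ℝ (a := m + d) (b := b), ← add_assoc m d b]
  have hf : ∀ k : ℕ, (k.factorial : ℝ) ≠ 0 := fun k => Nat.cast_ne_zero.mpr k.factorial_ne_zero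
  have := hf j; have := hf a; have := hf d; have := hf b; have := hf (m + j); have := hf (m + d)
  have := hf (m + j + a); have := hf (m + d + b); have := hf (j + a); have := hf (d + b)
  have := hf (j + d); have := hf (j + a + (d + b)); have := hf (m + j + (m + d))
  have := hf (m + j + a + (m + d + b))
  field_simp

lemma sum_choose_shift (N m k p q : ℕ) (hp : m + k ≤ p) (hq : m ≤ q) :
    ∑ i ∈ range (N + 1), (m + i + k).choose p * (N - i + m).choose q =
      (N + 2 * m + k + 1).choose (p + q + 1) := by
  rw [← sum_choose_mul_choose_sub (N + 2 * m + k) p q,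
    show N + 2 * m + k + 1 = (m + k) + ((N + 1) + m) by ring, sum_range_add _ (m + k),
    sum_range_add _ (N + 1) m]
  rw [sum_eq_zero (s := range (m + k)), sum_eq_zero (s := range m), zero_add, add_zero]
  · refine sum_congr rfl fun i hi => ?_
    have := mem_range.mp hi
    congr 2 <;> omega
  · intro i hi
    have := mem_range.mp hi
    rw [Nat.choose_eq_zero_of_lt (by omega : _ < q), mul_zero]
  · intro i hi
    have := mem_range.mp hi
    rw [Nat.choose_eq_zero_of_lt (by omega : _ < p), zero_mul]

lemma Tcoef_eq_sum (N m l i : ℕ) (n : ℕ) (hn : n = N + 2 * m) :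
    Tcoef n m l i = ∑ j ∈ range (l + 1), (-1 : ℝ) ^ (m + j) *
      (((2 * m + l).choose (m + j)) * (i.choose j) * ((N - i).choose (l - j))) := by
  have hN : n - 2 * m = N := by omega
  rw [Tcoef, hN, ← sum_filter]
  refine sum_subset_zero_on_sdiff ?_ ?_ ?_
  · intro j hj
    simp only [mem_filter, mem_range] at hj ⊢
    omega
  · intro j hj
    simp only [mem_filter, mem_sdiff, mem_range] at hj
    rw [Nat.choose_eq_zero_of_lt (by omega : i < j)]
    simp
  · intro j _
    ring

lemma sum_Tcoef_mul_ascFactorial (N m l k : ℕ) (hk : k < l) :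
    ∑ i ∈ range (N + 1), (N.choose i : ℝ) / ((N + 2 * m).choose (m + i)) *
      Tcoef (N + 2 * m) m l i * ((m + i + 1).ascFactorial k : ℕ) = 0 := by
  set c : ℝ := N.factorial * (2 * m + l).factorial / ((N + 2 * m).factorial * l.factorial)
  have key : ∀ i ∈ range (N + 1), (N.choose i : ℝ) / ((N + 2 * m).choose (m + i)) *
      Tcoef (N + 2 * m) m l i * ((m + i + 1).ascFactorial k : ℕ) =
      ∑ j ∈ range (l + 1), c * (-1) ^ (m + j) * (l.choose j) * ((m + j + 1).ascFactorial k : ℕ) *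
        (((m + i + k).choose (m + j + k) * (N - i + m).choose (m + (l - j)) : ℕ) : ℝ) := by
    intro i hi
    rw [Tcoef_eq_sum N m l i _ rfl, mul_sum, sum_mul]
    refine sum_congr rfl fun j hj => ?_
    have h1 := choose_div_mul_choose N m l i j (Nat.lt_succ_iff.mp (mem_range.mp hi))
      (Nat.lt_succ_iff.mp (mem_range.mp hj))
    have h2 : (((m + i + 1).ascFactorial k : ℕ) : ℝ) * ((m + i).choose (m + j)) =
        ((m + i + k).choose (m + j + k)) * ((m + j + 1).ascFactorial k : ℕ) := by
      exact_mod_cast ascFactorial_mul_choose (m + i) (m + j) k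
    push_cast
    linear_combination (-1) ^ (m + j) * ((m + i + 1).ascFactorial k : ℝ) * h1 +
      c * (-1) ^ (m + j) * (l.choose j) * ((N - i + m).choose (m + (l - j))) * h2
  rw [sum_congr rfl key, sum_comm]
  have key2 : ∀ j ∈ range (l + 1), ∑ i ∈ range (N + 1),
      c * (-1) ^ (m + j) * (l.choose j) * ((m + j + 1).ascFactorial k : ℕ) *
        (((m + i + k).choose (m + j + k) * (N - i + m).choose (m + (l - j)) : ℕ) : ℝ) =
      (c * (-1) ^ m * ((N + 2 * m + k + 1).choose (2 * m + l + k + 1) : ℕ)) *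
        ((-1) ^ j * (l.choose j) *
          ((ascPochhammer ℝ k).comp (Polynomial.X + Polynomial.C (m + 1 : ℝ))).eval (j : ℝ)) := by
    intro j hj
    have hj' := mem_range.mp hj
    rw [← mul_sum, ← Nat.cast_sum, sum_choose_shift N m k _ _ (by omega) (by omega),
      show m + j + k + (m + (l - j)) + 1 = 2 * m + l + k + 1 by omega]
    have : ((ascPochhammer ℝ k).comp (Polynomial.X + Polynomial.C (m + 1 : ℝ))).eval (j : ℝ) =
        ((m + j + 1).ascFactorial k : ℕ) := by
      rw [← ascPochhammer_nat_eq_natCast_ascFactorial, Polynomial.eval_comp]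
      congr 1
      simp
      ring
    rw [this]
    ring
  rw [sum_congr rfl key2, ← mul_sum, sum_alternating_choose_mul_eval, mul_zero]
  rw [Polynomial.natDegree_comp, ascPochhammer_natDegree, Polynomial.natDegree_X_add_C, mul_one]
  exact hk

lemma sum_Tcoef_mul_eval (N m l : ℕ) (P : Polynomial ℝ) (hP : P.degree < l) :
    ∑ i ∈ range (N + 1), (N.choose i : ℝ) / ((N + 2 * m).choose (m + i)) *
      Tcoef (N + 2 * m) m l i * P.eval (i : ℝ) = 0 := by
  have hmon : ∀ k, ((ascPochhammer ℝ k).comp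
      (Polynomial.X + Polynomial.C (m + 1 : ℝ))).Monic := fun k =>
    (monic_ascPochhammer ℝ k).comp_X_add_C _
  let S : Polynomial.Sequence ℝ :=
    { elems' := fun k => (ascPochhammer ℝ k).comp (Polynomial.X + Polynomial.C (m + 1 : ℝ))
      degree_eq' := fun k => by
        rw [Polynomial.degree_eq_natDegree (hmon k).ne_zero, Polynomial.natDegree_comp,
          ascPochhammer_natDegree, Polynomial.natDegree_X_add_C, mul_one] }
  have hspan := S.span_degreeLT (m := l) (fun i _ => by
    rw [show (S i).leadingCoeff = 1 from hmon i]; exact isUnit_one)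
  rw [← Polynomial.mem_degreeLT, ← hspan] at hP
  induction hP using Submodule.span_induction with
  | mem P h =>
    obtain ⟨k, hk, rfl⟩ := h
    rw [← sum_Tcoef_mul_ascFactorial N m l k hk]
    refine sum_congr rfl fun i _ => ?_
    congr 1
    rw [← ascPochhammer_nat_eq_natCast_ascFactorial]
    change Polynomial.eval _ ((ascPochhammer ℝ k).comp _) = _
    rw [Polynomial.eval_comp]
    congr 1
    simp
    ring
  | zero => simp
  | add P Q _ _ hP hQ => simp only [Polynomial.eval_add, mul_add, sum_add_distrib, hP, hQ, add_zero]
  | smul a P _ hP =>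
    simp only [Polynomial.eval_smul, smul_eq_mul, mul_left_comm _ a, ← mul_sum, hP, mul_zero]

lemma cast_choose_eq_eval (i j : ℕ) :
    (i.choose j : ℝ) = ((j.factorial : ℝ)⁻¹) * (descPochhammer ℝ j).eval (i : ℝ) := by
  rw [descPochhammer_eval_eq_descFactorial, Nat.descFactorial_eq_factorial_mul_choose]
  have : (j.factorial : ℝ) ≠ 0 := Nat.cast_ne_zero.mpr j.factorial_ne_zero
  push_cast
  field_simp

lemma exists_polynomial_Tcoef (N m l : ℕ) :
    ∃ P : Polynomial ℝ, P.natDegree ≤ l ∧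
      ∀ i ≤ N, Tcoef (N + 2 * m) m l i = P.eval (i : ℝ) := by
  refine ⟨∑ j ∈ range (l + 1), Polynomial.C ((-1 : ℝ) ^ (m + j) * ((2 * m + l).choose (m + j)) *
      (j.factorial : ℝ)⁻¹ * ((l - j).factorial : ℝ)⁻¹) *
      (descPochhammer ℝ j * (descPochhammer ℝ (l - j)).comp
        (Polynomial.C (N : ℝ) - Polynomial.X)), ?_, ?_⟩
  · refine Polynomial.natDegree_sum_le_of_forall_le _ _ fun j hj => ?_
    have hj' := mem_range.mp hj
    refine (Polynomial.natDegree_C_mul_le _ _).trans (Polynomial.natDegree_mul_le.trans ?_)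
    have h1 : (Polynomial.C (N : ℝ) - Polynomial.X).natDegree ≤ 1 := by
      compute_degree
    rw [Polynomial.natDegree_comp, descPochhammer_natDegree, descPochhammer_natDegree]
    nlinarith [Nat.mul_le_mul_left (l - j) h1, Nat.sub_add_cancel (Nat.lt_succ_iff.mp hj')]
  · intro i hi
    rw [Tcoef_eq_sum N m l i _ rfl, Polynomial.eval_finsetSum]
    refine sum_congr rfl fun j _ => ?_
    rw [cast_choose_eq_eval i j, cast_choose_eq_eval (N - i) (l - j)]
    simp only [Polynomial.eval_mul, Polynomial.eval_C, Polynomial.eval_comp, Polynomial.eval_sub,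
      Polynomial.eval_X, Nat.cast_sub hi]
    ring

lemma sum_Tcoef_mul_Tcoef (N m l l' : ℕ) (h : l' ≠ l) :
    ∑ i ∈ range (N + 1), (N.choose i : ℝ) / ((N + 2 * m).choose (m + i)) *
      Tcoef (N + 2 * m) m l i * Tcoef (N + 2 * m) m l' i = 0 := by
  wlog hl : l' < l generalizing l l'
  · rw [← this l' l h.symm (by omega)]
    exact sum_congr rfl fun i _ => by ring
  obtain ⟨P, hP, hPe⟩ := exists_polynomial_Tcoef N m l'
  rw [← sum_Tcoef_mul_eval N m l P
    (Polynomial.degree_le_natDegree.trans_lt (by exact_mod_cast hP.trans_lt hl))]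
  exact sum_congr rfl fun i hi => by rw [hPe i (Nat.lt_succ_iff.mp (mem_range.mp hi))]

lemma Tcoef_zero_ne_zero (N m l : ℕ) (hl : l ≤ N) : Tcoef (N + 2 * m) m l 0 ≠ 0 := by
  have h1 : (2 * m + l).choose m ≠ 0 := (Nat.choose_pos (by omega)).ne'
  have h2 : N.choose l ≠ 0 := (Nat.choose_pos hl).ne'
  simp [Tcoef, h1, h2]
/-! ### Murphy operators and adjacent transpositions -/

lemma image_swap_image_perm (σ : Equiv.Perm ℕ) (i r : ℕ) (U : Finset ℕ) :
    (U.image (Equiv.swap i r)).image σ = (U.image σ).image (Equiv.swap (σ i) (σ r)) := by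
  rw [image_image, image_image]
  congr 1
  funext x
  exact congrArg (fun τ : Equiv.Perm ℕ => τ x) (Equiv.mul_swap_eq_swap_mul σ i r)

lemma image_swap_image_swap (a b : ℕ) (U : Finset ℕ) :
    (U.image (Equiv.swap a b)).image (Equiv.swap a b) = U := by
  rw [image_image]
  have : (Equiv.swap a b : ℕ → ℕ) ∘ Equiv.swap a b = id := by
    funext x
    simp
  rw [this, image_id]

lemma sOp_sOp (t : ℕ) (f : Finset ℕ → ℝ) : sOp t (sOp t f) = f := by
  funext U
  rw [sOp, sOp, image_swap_image_swap]

lemma murphy_sOp_of_lt {t r : ℕ} (h : r < t) (f : Finset ℕ → ℝ) :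
    murphy r (sOp t f) = sOp t (murphy r f) := by
  funext U
  refine sum_congr rfl fun i hi => ?_
  have hi' := mem_Icc.mp hi
  rw [sOp, image_swap_image_perm, Equiv.swap_apply_of_ne_of_ne (by omega) (by omega),
    Equiv.swap_apply_of_ne_of_ne (by omega) (by omega)]

lemma murphy_sOp_of_gt {t r : ℕ} (ht : 1 ≤ t) (h : t + 1 < r) (f : Finset ℕ → ℝ) :
    murphy r (sOp t f) = sOp t (murphy r f) := by
  funext U
  change murphy r (sOp t f) U = murphy r f (U.image (Equiv.swap t (t + 1)))
  unfold murphy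
  refine sum_nbij' (Equiv.swap t (t + 1)) (Equiv.swap t (t + 1)) ?_ ?_ ?_ ?_ ?_
  · intro i hi
    rw [Equiv.swap_apply_def]
    simp only [mem_Icc] at hi ⊢
    split_ifs <;> omega
  · intro i hi
    rw [Equiv.swap_apply_def]
    simp only [mem_Icc] at hi ⊢
    split_ifs <;> omega
  · simp
  · simp
  · intro i _
    rw [sOp, image_swap_image_perm,
      Equiv.swap_apply_of_ne_of_ne (x := r) (by omega) (by omega)]

lemma murphy_succ (t : ℕ) (ht : 1 ≤ t) (f : Finset ℕ → ℝ) (U : Finset ℕ) :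
    murphy (t + 1) f U =
      ∑ i ∈ Icc 1 (t - 1), f (U.image (Equiv.swap i (t + 1))) + sOp t f U := by
  obtain ⟨s, rfl⟩ := Nat.exists_eq_add_of_le' ht
  rw [murphy, Nat.add_sub_cancel, sum_Icc_succ_top (by omega)]
  rfl

lemma murphy_sOp_self {t : ℕ} (ht : 1 ≤ t) (f : Finset ℕ → ℝ) :
    murphy t (sOp t f) = sOp t (murphy (t + 1) f) - f := by
  funext U
  have h := congrFun (sOp_sOp t f) U
  rw [sOp] at h
  rw [Pi.sub_apply, sOp, murphy_succ t ht, h, add_sub_cancel_right]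
  refine sum_congr rfl fun i hi => ?_
  have hi' := mem_Icc.mp hi
  rw [sOp, image_swap_image_perm, Equiv.swap_apply_of_ne_of_ne (x := i) (by omega) (by omega),
    Equiv.swap_apply_left]

lemma murphy_sOp_succ {t : ℕ} (ht : 1 ≤ t) (f : Finset ℕ → ℝ) :
    murphy (t + 1) (sOp t f) = sOp t (murphy t f) + f := by
  funext U
  rw [Pi.add_apply, murphy_succ t ht, sOp_sOp]
  congr 1
  refine sum_congr rfl fun i hi => ?_
  have hi' := mem_Icc.mp hi
  rw [sOp, image_swap_image_perm, Equiv.swap_apply_of_ne_of_ne (x := i) (by omega) (by omega),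
    Equiv.swap_apply_right]

lemma murphy_sub_smul (r : ℕ) (f g : Finset ℕ → ℝ) (c : ℝ) :
    murphy r (f - c • g) = murphy r f - c • murphy r g := by
  funext U
  simp [murphy, mul_sum, sum_sub_distrib]

lemma sOp_smul (t : ℕ) (f : Finset ℕ → ℝ) (c : ℝ) : sOp t (c • f) = c • sOp t f := rfl

lemma tauFactor_eq (r t : ℕ) (f : Finset ℕ → ℝ) :
    tauFactor r t f = sOp t f - ((t : ℝ) - 2 * r + 2)⁻¹ • f := rfl

/-! ### Joint Murphy eigenvectors indexed by second rows of two-row tableaux -/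

/-- The content of the entry `r` in the two-row tableau with second row `S`. -/
noncomputable def tabContent (S : Finset ℕ) (r : ℕ) : ℝ :=
  if r ∈ S then ((S.filter (· < r)).card : ℝ) - 1 else (r : ℝ) - 1 - (S.filter (· < r)).card

/-- `f` is a joint eigenvector of the Murphy operators with the contents of the two-row tableau
with second row `S` as eigenvalues. -/
def IsMurphyEigen (n : ℕ) (S : Finset ℕ) (f : Finset ℕ → ℝ) : Prop :=
  ∀ r ∈ Icc 1 n, murphy r f = tabContent S r • f

/-- Move the entry `a` of the second row to the value `b`. -/
noncomputable def moveEntry (S : Finset ℕ) (a b : ℕ) : Finset ℕ := insert b (S.erase a)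

lemma filter_moveEntry_lt {S : Finset ℕ} {t r : ℕ} (hr : r ≤ t) :
    (moveEntry S t (t + 1)).filter (· < r) = S.filter (· < r) := by
  ext x
  simp only [moveEntry, mem_filter, mem_insert, mem_erase]
  constructor
  · rintro ⟨h | h, h'⟩
    · omega
    · exact ⟨h.2, h'⟩
  · rintro ⟨h, h'⟩
    exact ⟨Or.inr ⟨by omega, h⟩, h'⟩

lemma card_filter_succ_of_mem {S : Finset ℕ} {t : ℕ} (h : t ∈ S) :
    (S.filter (· < t + 1)).card = (S.filter (· < t)).card + 1 := by
  have : S.filter (· < t + 1) = insert t (S.filter (· < t)) := by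
    ext x
    simp only [mem_filter, mem_insert]
    constructor
    · rintro ⟨hx, hx'⟩
      rcases Nat.lt_succ_iff_lt_or_eq.mp hx' with h' | h'
      · exact Or.inr ⟨hx, h'⟩
      · exact Or.inl h'
    · rintro (rfl | ⟨hx, hx'⟩)
      · exact ⟨h, by omega⟩
      · exact ⟨hx, by omega⟩
  rw [this, card_insert_of_notMem (by simp)]

lemma card_filter_succ_of_notMem {S : Finset ℕ} {t : ℕ} (h : t ∉ S) :
    (S.filter (· < t + 1)).card = (S.filter (· < t)).card := by
  congr 1
  ext x
  simp only [mem_filter]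
  constructor
  · rintro ⟨hx, hx'⟩
    exact ⟨hx, lt_of_le_of_ne (Nat.lt_succ_iff.mp hx') (fun e => h (e ▸ hx))⟩
  · rintro ⟨hx, hx'⟩
    exact ⟨hx, by omega⟩

lemma mem_moveEntry_of_ne {S : Finset ℕ} {t r : ℕ} (h : r ≠ t) (h' : r ≠ t + 1) :
    r ∈ moveEntry S t (t + 1) ↔ r ∈ S := by
  simp [moveEntry, h, h']

section MoveEntry

variable {S : Finset ℕ} {t : ℕ}

lemma card_filter_moveEntry_gt (h0 : t ∈ S) (h1 : t + 1 ∉ S) {r : ℕ} (hr : t + 1 < r) :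
    ((moveEntry S t (t + 1)).filter (· < r)).card = (S.filter (· < r)).card := by
  have e1 : (moveEntry S t (t + 1)).filter (· < r) = insert (t + 1) ((S.filter (· < r)).erase t) := by
    ext x
    simp only [moveEntry, mem_filter, mem_insert, mem_erase]
    constructor
    · tauto
    · rintro (rfl | h)
      · exact ⟨Or.inl rfl, hr⟩
      · tauto
  have h2 : t ∈ S.filter (· < r) := mem_filter.mpr ⟨h0, by omega⟩
  rw [e1, card_insert_of_notMem (by simp [h1]), card_erase_add_one h2]

lemma tabContent_moveEntry_of_ne (h0 : t ∈ S) (h1 : t + 1 ∉ S) {r : ℕ} (hr : r ≠ t)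
    (hr' : r ≠ t + 1) : tabContent (moveEntry S t (t + 1)) r = tabContent S r := by
  have hc : ((moveEntry S t (t + 1)).filter (· < r)).card = (S.filter (· < r)).card := by
    rcases lt_or_gt_of_ne hr with h | h
    · rw [filter_moveEntry_lt h.le]
    · exact card_filter_moveEntry_gt h0 h1 (by omega)
  simp only [tabContent, mem_moveEntry_of_ne hr hr', hc]

lemma tabContent_of_mem (h0 : t ∈ S) : tabContent S t = ((S.filter (· < t)).card : ℝ) - 1 :=
  if_pos h0

lemma tabContent_succ (h0 : t ∈ S) (h1 : t + 1 ∉ S) :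
    tabContent S (t + 1) = (t : ℝ) - 1 - (S.filter (· < t)).card := by
  rw [tabContent, if_neg h1, card_filter_succ_of_mem h0]
  push_cast
  ring

lemma tabContent_moveEntry_self :
    tabContent (moveEntry S t (t + 1)) t = (t : ℝ) - 1 - (S.filter (· < t)).card := by
  rw [tabContent, if_neg (by simp [moveEntry]), filter_moveEntry_lt le_rfl]

lemma tabContent_moveEntry_succ :
    tabContent (moveEntry S t (t + 1)) (t + 1) = ((S.filter (· < t)).card : ℝ) - 1 := by
  rw [tabContent, if_pos (by simp [moveEntry]), card_filter_succ_of_notMem (by simp [moveEntry]),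
    filter_moveEntry_lt le_rfl]

/-- Young's seminormal intertwiner exchanges the Murphy eigenvalues at `t` and `t + 1`. -/
lemma IsMurphyEigen.tauFactor {n r : ℕ} {f : Finset ℕ → ℝ} (hf : IsMurphyEigen n S f)
    (ht : 1 ≤ t) (htn : t + 1 ≤ n) (h0 : t ∈ S) (h1 : t + 1 ∉ S)
    (hr : (S.filter (· < t)).card + 1 = r) (hne : 2 * r ≤ t) :
    IsMurphyEigen n (moveEntry S t (t + 1)) (tauFactor r t f) := by
  have hr' : (r : ℝ) = (S.filter (· < t)).card + 1 := by exact_mod_cast hr.symm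
  have hc : (t : ℝ) - 2 * r + 2 ≠ 0 := by
    have : (2 * r : ℝ) ≤ t := by exact_mod_cast hne
    linarith
  have hft := hf t (mem_Icc.mpr ⟨ht, by omega⟩)
  have hfs := hf (t + 1) (mem_Icc.mpr ⟨by omega, htn⟩)
  rw [tabContent_of_mem h0] at hft
  rw [tabContent_succ h0 h1] at hfs
  intro s hs
  have hs' := mem_Icc.mp hs
  rw [tauFactor_eq, murphy_sub_smul]
  rcases eq_or_ne s t with rfl | hst
  · rw [murphy_sOp_self ht, hft, hfs, tabContent_moveEntry_self]
    funext U
    simp only [sOp_smul, Pi.sub_apply, Pi.smul_apply, smul_eq_mul]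
    field_simp
    rw [hr']
    ring
  rcases eq_or_ne s (t + 1) with rfl | hst'
  · rw [murphy_sOp_succ ht, hft, hfs, tabContent_moveEntry_succ]
    funext U
    simp only [sOp_smul, Pi.sub_apply, Pi.add_apply, Pi.smul_apply, smul_eq_mul]
    field_simp
    rw [hr']
    ring
  · rw [tabContent_moveEntry_of_ne h0 h1 hst hst', hf s hs]
    have : murphy s (sOp t f) = sOp t (murphy s f) := by
      rcases lt_or_gt_of_ne hst with h | h
      · exact murphy_sOp_of_lt h f
      · exact murphy_sOp_of_gt ht (by omega) f
    rw [this, hf s hs, sOp_smul, smul_sub, smul_comm]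

end MoveEntry

/-! ### Invariance of the inner product -/

lemma image_swap_subset_Icc {n a b : ℕ} (ha : a ∈ Icc 1 n) (hb : b ∈ Icc 1 n) {U : Finset ℕ}
    (hU : U ⊆ Icc 1 n) : U.image (Equiv.swap a b) ⊆ Icc 1 n := by
  intro x hx
  obtain ⟨y, hy, rfl⟩ := mem_image.mp hx
  rw [Equiv.swap_apply_def]
  split_ifs
  · exact hb
  · exact ha
  · exact hU hy

lemma innerPi_swap {n a b : ℕ} (ha : a ∈ Icc 1 n) (hb : b ∈ Icc 1 n) (f g : Finset ℕ → ℝ) :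
    innerPi n (fun U => f (U.image (Equiv.swap a b))) g =
      innerPi n f (fun U => g (U.image (Equiv.swap a b))) := by
  refine sum_nbij' (fun U => U.image (Equiv.swap a b)) (fun U => U.image (Equiv.swap a b))
    ?_ ?_ ?_ ?_ ?_
  · intro U hU
    exact mem_powerset.mpr (image_swap_subset_Icc ha hb (mem_powerset.mp hU))
  · intro U hU
    exact mem_powerset.mpr (image_swap_subset_Icc ha hb (mem_powerset.mp hU))
  · intro U _
    exact image_swap_image_swap a b U
  · intro U _
    exact image_swap_image_swap a b U
  · intro U _
    simp only [image_swap_image_swap, piDist, card_image_of_injective _ (Equiv.injective _)]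

lemma innerPi_comm (n : ℕ) (f g : Finset ℕ → ℝ) : innerPi n f g = innerPi n g f :=
  sum_congr rfl fun _ _ => by ring

lemma innerPi_smul_left (n : ℕ) (c : ℝ) (f g : Finset ℕ → ℝ) :
    innerPi n (c • f) g = c * innerPi n f g := by
  simp only [innerPi, mul_sum, Pi.smul_apply, smul_eq_mul, mul_assoc]

lemma innerPi_smul_right (n : ℕ) (c : ℝ) (f g : Finset ℕ → ℝ) :
    innerPi n f (c • g) = c * innerPi n f g := by
  rw [innerPi_comm, innerPi_smul_left, innerPi_comm]

lemma innerPi_sub_left (n : ℕ) (f g h : Finset ℕ → ℝ) :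
    innerPi n (f - g) h = innerPi n f h - innerPi n g h := by
  simp only [innerPi, ← sum_sub_distrib, Pi.sub_apply, sub_mul]

lemma innerPi_sub_right (n : ℕ) (f g h : Finset ℕ → ℝ) :
    innerPi n f (g - h) = innerPi n f g - innerPi n f h := by
  rw [innerPi_comm, innerPi_sub_left, innerPi_comm, innerPi_comm n h]

lemma innerPi_sum_left (n : ℕ) (s : Finset ℕ) (F : ℕ → Finset ℕ → ℝ) (g : Finset ℕ → ℝ) :
    innerPi n (fun U => ∑ i ∈ s, F i U) g = ∑ i ∈ s, innerPi n (F i) g := by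
  simp only [innerPi, sum_mul]
  exact sum_comm

lemma innerPi_murphy {n r : ℕ} (hr : r ∈ Icc 1 n) (f g : Finset ℕ → ℝ) :
    innerPi n (murphy r f) g = innerPi n f (murphy r g) := by
  have hr' := mem_Icc.mp hr
  unfold murphy
  rw [innerPi_sum_left, innerPi_comm, innerPi_sum_left]
  refine sum_congr rfl fun i hi => ?_
  have hi' := mem_Icc.mp hi
  rw [innerPi_swap (mem_Icc.mpr ⟨hi'.1, by omega⟩) hr, innerPi_comm]

lemma IsMurphyEigen.innerPi_eq_zero {n r : ℕ} {S S' : Finset ℕ} {f g : Finset ℕ → ℝ}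
    (hf : IsMurphyEigen n S f) (hg : IsMurphyEigen n S' g) (hr : r ∈ Icc 1 n)
    (h : tabContent S r ≠ tabContent S' r) : innerPi n f g = 0 := by
  have h1 := innerPi_murphy hr f g
  rw [hf r hr, hg r hr, innerPi_smul_left, innerPi_smul_right] at h1
  have h2 : (tabContent S r - tabContent S' r) * innerPi n f g = 0 := by linarith
  exact (mul_eq_zero.mp h2).resolve_left (sub_ne_zero.mpr h)

lemma innerPi_sOp {n t : ℕ} (ht : 1 ≤ t) (htn : t + 1 ≤ n) (f g : Finset ℕ → ℝ) :
    innerPi n (sOp t f) g = innerPi n f (sOp t g) :=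
  innerPi_swap (mem_Icc.mpr ⟨ht, by omega⟩) (mem_Icc.mpr ⟨by omega, htn⟩) f g

lemma innerPi_tauFactor {n r t : ℕ} {S : Finset ℕ} {f g : Finset ℕ → ℝ}
    (hf : IsMurphyEigen n S f) (hg : IsMurphyEigen n S g)
    (ht : 1 ≤ t) (htn : t + 1 ≤ n) (h0 : t ∈ S) (h1 : t + 1 ∉ S)
    (hr : (S.filter (· < t)).card + 1 = r) (hne : 2 * r ≤ t) :
    innerPi n (tauFactor r t f) (tauFactor r t g) =
      (1 - (((t : ℝ) - 2 * r + 2)⁻¹) ^ 2) * innerPi n f g := by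
  have hr' : (r : ℝ) = (S.filter (· < t)).card + 1 := by exact_mod_cast hr.symm
  have hlt : (2 * r : ℝ) ≤ t := by exact_mod_cast hne
  have hz : ∀ {u v : Finset ℕ → ℝ}, IsMurphyEigen n S u → IsMurphyEigen n S v →
      innerPi n (tauFactor r t u) v = 0 := fun hu hv =>
    (hu.tauFactor ht htn h0 h1 hr hne).innerPi_eq_zero hv (mem_Icc.mpr ⟨ht, by omega⟩) (by
      rw [tabContent_moveEntry_self, tabContent_of_mem h0]
      intro h
      linarith)
  have h2 := hz hf hg
  simp only [tauFactor_eq, innerPi_sub_left, innerPi_sub_right, innerPi_smul_left,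
    innerPi_smul_right] at h2 ⊢
  rw [innerPi_sOp ht htn f (sOp t g), sOp_sOp, ← innerPi_sOp ht htn f g]
  linear_combination (-2 * ((t : ℝ) - 2 * r + 2)⁻¹) * h2

/-! ### The operators `tauQ` -/

lemma moveEntry_self {S : Finset ℕ} {a : ℕ} (h : a ∈ S) : moveEntry S a a = S :=
  insert_erase h

lemma moveEntry_moveEntry {S : Finset ℕ} {a b c : ℕ} (h : b ∈ S → b = a) :
    moveEntry (moveEntry S a b) b c = moveEntry S a c := by
  rw [moveEntry, moveEntry, erase_insert, moveEntry]
  rw [mem_erase]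
  tauto

lemma filter_moveEntry_lt_of_gap {S : Finset ℕ} {a k : ℕ}
    (hgap : ∀ j, 1 ≤ j → j < k → a + j ∉ S) :
    (moveEntry S a (a + k)).filter (· < a + k) = S.filter (· < a) := by
  ext x
  simp only [moveEntry, mem_filter, mem_insert, mem_erase]
  constructor
  · rintro ⟨h | ⟨hx, hxS⟩, h'⟩
    · omega
    · refine ⟨hxS, ?_⟩
      by_contra hlt
      refine hgap (x - a) (by omega) (by omega) ?_
      rwa [Nat.add_sub_cancel' (by omega)]
  · rintro ⟨h, h'⟩
    exact ⟨Or.inr ⟨by omega, h⟩, by omega⟩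

lemma tauComp_eigen_and_inner {n r k : ℕ} {S : Finset ℕ} (hn : 2 * r + k ≤ n)
    (h0 : 2 * r ∈ S) (hgap : ∀ j, 1 ≤ j → j ≤ k → 2 * r + j ∉ S)
    (hr : (S.filter (· < 2 * r)).card + 1 = r) :
    (∀ f, IsMurphyEigen n S f →
      IsMurphyEigen n (moveEntry S (2 * r) (2 * r + k)) (tauComp r k f)) ∧
    ∃ γ : ℝ, 0 < γ ∧ ∀ f g, IsMurphyEigen n S f → IsMurphyEigen n S g →
      innerPi n (tauComp r k f) (tauComp r k g) = γ * innerPi n f g := by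
  induction k with
  | zero =>
    refine ⟨fun f hf => ?_, 1, one_pos, fun f g _ _ => (one_mul _).symm⟩
    rw [add_zero, moveEntry_self h0]
    exact hf
  | succ k ih =>
    obtain ⟨he, γ, hγ, hi⟩ := ih (by omega) fun j h1 h2 => hgap j h1 (by omega)
    have hfil := filter_moveEntry_lt_of_gap (a := 2 * r) (k := k)
      fun j h1 h2 => hgap j h1 (by omega)
    have m0 : 2 * r + k ∈ moveEntry S (2 * r) (2 * r + k) := mem_insert_self _ _
    have m1 : 2 * r + k + 1 ∉ moveEntry S (2 * r) (2 * r + k) := by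
      simp only [moveEntry, mem_insert, mem_erase, not_or, not_and]
      exact ⟨by omega, fun _ => hgap (k + 1) (by omega) le_rfl⟩
    have hr' : ((moveEntry S (2 * r) (2 * r + k)).filter (· < 2 * r + k)).card + 1 = r := by
      rw [hfil, hr]
    have hmv : moveEntry (moveEntry S (2 * r) (2 * r + k)) (2 * r + k) (2 * r + k + 1) =
        moveEntry S (2 * r) (2 * r + (k + 1)) := by
      refine moveEntry_moveEntry fun h => ?_
      rcases Nat.eq_zero_or_pos k with rfl | hk
      · rfl
      · exact absurd h (hgap k hk (by omega))
    refine ⟨fun f hf => ?_, (1 - (((2 * r + k : ℕ) : ℝ) - 2 * r + 2)⁻¹ ^ 2) * γ, mul_pos ?_ hγ,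
      fun f g hf hg => ?_⟩
    · rw [← hmv]
      exact (he f hf).tauFactor (by omega) (by omega) m0 m1 hr' (by omega)
    · have hk : ((2 * r + k : ℕ) : ℝ) - 2 * r + 2 = k + 2 := by
        push_cast
        ring
      have hk0 : (0 : ℝ) ≤ k := k.cast_nonneg
      rw [hk, sub_pos]
      exact pow_lt_one₀ (by positivity) (inv_lt_one_of_one_lt₀ (by linarith)) two_ne_zero
    · rw [mul_assoc, ← hi f g hf hg]
      exact innerPi_tauFactor (he f hf) (he g hg) (by omega) (by omega) m0 m1 hr' (by omega)

/-- The second row `{2, 4, …, 2k}` of the column reading tableau. -/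
noncomputable def evenRow (k : ℕ) : Finset ℕ := (range k).image fun j => 2 * (j + 1)

lemma mem_evenRow {k x : ℕ} : x ∈ evenRow k ↔ ∃ j < k, 2 * (j + 1) = x := by
  simp [evenRow]

lemma card_evenRow (k : ℕ) : (evenRow k).card = k := by
  rw [evenRow, card_image_of_injective _ fun a b h => by simpa using h, card_range]

lemma tauQAux_eigen_and_inner {n : ℕ} (Q : List ℕ) (s : ℕ) (hQ : Q.Pairwise (· < ·))
    (hn : ∀ x ∈ Q, x ≤ n) (hb : ∀ i < Q.length, 2 * (s + i + 1) ≤ Q.getD i 0) :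
    (∀ f, IsMurphyEigen n (evenRow (s + Q.length)) f →
      IsMurphyEigen n (evenRow s ∪ Q.toFinset) (tauQAux (s + 1) Q f)) ∧
    ∃ γ : ℝ, 0 < γ ∧ ∀ f g, IsMurphyEigen n (evenRow (s + Q.length)) f →
      IsMurphyEigen n (evenRow (s + Q.length)) g →
      innerPi n (tauQAux (s + 1) Q f) (tauQAux (s + 1) Q g) = γ * innerPi n f g := by
  induction Q generalizing s with
  | nil =>
    refine ⟨fun f hf => ?_, 1, one_pos, fun f g _ _ => (one_mul _).symm⟩
    simpa [tauQAux] using hf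
  | cons a Q ih =>
    obtain ⟨ha, hQ'⟩ := List.pairwise_cons.mp hQ
    obtain ⟨he, γ, hγ, hi⟩ := ih (s + 1) hQ' (fun x hx => hn x (List.mem_cons_of_mem _ hx))
      (fun i hi => by
        have := hb (i + 1) (by simpa using hi)
        rw [List.getD_cons_succ] at this
        omega)
    have hlen : s + (a :: Q).length = s + 1 + Q.length := by
      rw [List.length_cons]
      ring
    have has : 2 * (s + 1) ≤ a := by simpa using hb 0 (by simp)
    have han : a ≤ n := hn a List.mem_cons_self
    obtain ⟨k, rfl⟩ := Nat.exists_eq_add_of_le has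
    have h0 : 2 * (s + 1) ∈ evenRow (s + 1) ∪ Q.toFinset :=
      mem_union_left _ (mem_evenRow.mpr ⟨s, by omega, rfl⟩)
    have hgap : ∀ j, 1 ≤ j → j ≤ k → 2 * (s + 1) + j ∉ evenRow (s + 1) ∪ Q.toFinset := by
      intro j h1 h2 hj
      rcases mem_union.mp hj with h | h
      · obtain ⟨i, hi, hi'⟩ := mem_evenRow.mp h
        omega
      · have := ha _ (List.mem_toFinset.mp h)
        omega
    have hfil : (evenRow (s + 1) ∪ Q.toFinset).filter (· < 2 * (s + 1)) = evenRow s := by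
      ext x
      simp only [mem_filter, mem_union, mem_evenRow, List.mem_toFinset]
      constructor
      · rintro ⟨⟨j, hj, rfl⟩ | h, hx⟩
        · exact ⟨j, by omega, rfl⟩
        · have := ha _ h
          omega
      · rintro ⟨j, hj, rfl⟩
        exact ⟨Or.inl ⟨j, by omega, rfl⟩, by omega⟩
    have hmv : moveEntry (evenRow (s + 1) ∪ Q.toFinset) (2 * (s + 1)) (2 * (s + 1) + k) =
        evenRow s ∪ ((2 * (s + 1) + k) :: Q).toFinset := by
      ext x
      simp only [moveEntry, mem_insert, mem_erase, mem_union, mem_evenRow, List.mem_toFinset,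
        List.mem_cons]
      constructor
      · rintro (rfl | ⟨hx, ⟨j, hj, rfl⟩ | h⟩)
        · exact Or.inr (Or.inl rfl)
        · exact Or.inl ⟨j, by omega, rfl⟩
        · exact Or.inr (Or.inr h)
      · rintro (⟨j, hj, rfl⟩ | h | h)
        · exact Or.inr ⟨by omega, Or.inl ⟨j, by omega, rfl⟩⟩
        · exact Or.inl h
        · have := ha _ h
          exact Or.inr ⟨by omega, Or.inr h⟩
    obtain ⟨ce, δ, hδ, ci⟩ := tauComp_eigen_and_inner (n := n) (r := s + 1) han h0 hgap
      (by rw [hfil, card_evenRow])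
    rw [hlen]
    have hk : ∀ f, tauQAux (s + 1) ((2 * (s + 1) + k) :: Q) f =
        tauComp (s + 1) k (tauQAux (s + 1 + 1) Q f) := fun f => by
      change tauComp (s + 1) (2 * (s + 1) + k - 2 * (s + 1)) _ = _
      rw [Nat.add_sub_cancel_left]
    refine ⟨fun f hf => ?_, δ * γ, mul_pos hδ hγ, fun f g hf hg => ?_⟩
    · rw [hk, ← hmv]
      exact ce _ (he f hf)
    · rw [hk, hk, ci _ _ (he f hf) (he g hg), hi f g hf hg, mul_assoc]

/-! ### Standard Young tableaux are separated by their contents -/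

lemma exists_tabContent_ne {n : ℕ} {S S' : Finset ℕ} (hS : S ⊆ Icc 1 n) (hS' : S' ⊆ Icc 1 n)
    (hb : ∀ t ∈ S, 2 * ((S.filter (· < t)).card + 1) ≤ t)
    (hb' : ∀ t ∈ S', 2 * ((S'.filter (· < t)).card + 1) ≤ t) (hne : S ≠ S') :
    ∃ r ∈ Icc 1 n, tabContent S r ≠ tabContent S' r := by
  have hex : ∃ r, ¬ (r ∈ S ↔ r ∈ S') := by
    by_contra! h
    exact hne (ext h)
  set r := Nat.find hex with hrdef
  have hr : ¬ (r ∈ S ↔ r ∈ S') := Nat.find_spec hex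
  have hlt : S.filter (· < r) = S'.filter (· < r) := by
    ext x
    simp only [mem_filter]
    refine and_congr_left fun hx => ?_
    exact not_not.mp (Nat.find_min hex hx)
  by_cases h : r ∈ S
  · have h' : r ∉ S' := fun h' => hr ⟨fun _ => h', fun _ => h⟩
    refine ⟨r, hS h, fun heq => ?_⟩
    have hb1 : (2 * (((S.filter (· < r)).card : ℝ) + 1)) ≤ r := by exact_mod_cast hb r h
    rw [tabContent, tabContent, if_pos h, if_neg h', ← hlt] at heq
    linarith
  · have h' : r ∈ S' := by tauto
    refine ⟨r, hS' h', fun heq => ?_⟩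
    have hb1 : (2 * (((S'.filter (· < r)).card : ℝ) + 1)) ≤ r := by exact_mod_cast hb' r h'
    rw [tabContent, tabContent, if_neg h, if_pos h', hlt] at heq
    linarith

lemma IsSYT.pairwise {n : ℕ} {Q : List ℕ} (h : IsSYT n Q) : Q.Pairwise (· < ·) :=
  List.isChain_iff_pairwise.mp h.1

lemma IsSYT.ballot {n : ℕ} {Q : List ℕ} (h : IsSYT n Q) :
    ∀ t ∈ Q.toFinset, 2 * ((Q.toFinset.filter (· < t)).card + 1) ≤ t := by
  intro t ht
  obtain ⟨i, hi, rfl⟩ := List.getElem_of_mem (List.mem_toFinset.mp ht)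
  have hp := List.pairwise_iff_getElem.mp h.pairwise
  have hsub : Q.toFinset.filter (· < Q[i]) ⊆ (range i).image fun j => Q.getD j 0 := by
    intro x hx
    obtain ⟨hx, hxi⟩ := mem_filter.mp hx
    obtain ⟨j, hj, rfl⟩ := List.getElem_of_mem (List.mem_toFinset.mp hx)
    refine mem_image.mpr ⟨j, mem_range.mpr ?_, by simp [hj]⟩
    by_contra! hij
    rcases hij.eq_or_lt with rfl | hij
    · exact lt_irrefl _ hxi
    · exact lt_asymm hxi (hp _ _ hi hj hij)
  have hc := (card_le_card hsub).trans card_image_le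
  rw [card_range] at hc
  have h2 := h.2.2 i hi
  rw [List.getD_eq_getElem _ _ hi] at h2
  omega

lemma IsSYT.subset_Icc {n : ℕ} {Q : List ℕ} (h : IsSYT n Q) : Q.toFinset ⊆ Icc 1 n := by
  intro t ht
  have := h.ballot t ht
  exact mem_Icc.mpr ⟨by omega, h.2.1 t (List.mem_toFinset.mp ht)⟩

lemma IsSYT.toFinset_injective {n : ℕ} {Q Q' : List ℕ} (h : IsSYT n Q) (h' : IsSYT n Q')
    (heq : Q.toFinset = Q'.toFinset) : Q = Q' :=
  (List.perm_of_nodup_nodup_toFinset_eq h.pairwise.nodup h'.pairwise.nodup heq).eq_of_pairwise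
    (fun _ _ _ _ h1 h2 => absurd h1 (lt_asymm h2)) h.pairwise h'.pairwise

/-! ### The column reading tableau -/

/-- The real-valued indicator of `a ∈ U`. -/
noncomputable def memInd (U : Finset ℕ) (a : ℕ) : ℝ := if a ∈ U then 1 else 0

/-- The `j`-th column factor, antisymmetric in `2j + 1` and `2j + 2`. -/
noncomputable def colFactor (j : ℕ) (U : Finset ℕ) : ℝ := memInd U (2 * j + 2) - memInd U (2 * j + 1)

/-- The product of the first `m` column factors. -/
noncomputable def colProd (m : ℕ) (U : Finset ℕ) : ℝ := ∏ j ∈ range m, colFactor j U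

/-- The number of elements of `U` outside the first `m` columns. -/
noncomputable def restCard (n m : ℕ) (U : Finset ℕ) : ℕ := (U ∩ Icc (2 * m + 1) n).card

lemma mem_image_swap {a b x : ℕ} {U : Finset ℕ} :
    x ∈ U.image (Equiv.swap a b) ↔ Equiv.swap a b x ∈ U := by
  constructor
  · intro h
    obtain ⟨y, hy, rfl⟩ := mem_image.mp h
    simpa using hy
  · intro h
    exact mem_image.mpr ⟨_, h, by simp⟩

lemma memInd_image_swap (a b x : ℕ) (U : Finset ℕ) :
    memInd (U.image (Equiv.swap a b)) x = memInd U (Equiv.swap a b x) := by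
  simp only [memInd, mem_image_swap]

lemma memInd_image_swap_left (a b : ℕ) (U : Finset ℕ) :
    memInd (U.image (Equiv.swap a b)) a = memInd U b := by
  rw [memInd_image_swap, Equiv.swap_apply_left]

lemma memInd_image_swap_right (a b : ℕ) (U : Finset ℕ) :
    memInd (U.image (Equiv.swap a b)) b = memInd U a := by
  rw [memInd_image_swap, Equiv.swap_apply_right]

lemma memInd_image_swap_of_ne {a b x : ℕ} (ha : x ≠ a) (hb : x ≠ b) (U : Finset ℕ) :
    memInd (U.image (Equiv.swap a b)) x = memInd U x := by
  rw [memInd_image_swap, Equiv.swap_apply_of_ne_of_ne ha hb]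

lemma memInd_eq_zero_or_one (U : Finset ℕ) (a : ℕ) : memInd U a = 0 ∨ memInd U a = 1 := by
  unfold memInd
  split_ifs <;> simp

lemma colFactor_image_swap_of_ne {a b i : ℕ} (h1 : 2 * i + 1 ≠ a) (h2 : 2 * i + 1 ≠ b)
    (h3 : 2 * i + 2 ≠ a) (h4 : 2 * i + 2 ≠ b) (U : Finset ℕ) :
    colFactor i (U.image (Equiv.swap a b)) = colFactor i U := by
  rw [colFactor, memInd_image_swap_of_ne h1 h2, memInd_image_swap_of_ne h3 h4, colFactor]

lemma colProd_eq_mul {m k : ℕ} (hk : k < m) (U : Finset ℕ) :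
    colProd m U = colFactor k U * ∏ i ∈ (range m).erase k, colFactor i U :=
  (mul_prod_erase _ _ (mem_range.mpr hk)).symm

lemma colProd_eq_mul_mul {m k j : ℕ} (hk : k < m) (hj : j < m) (hjk : j ≠ k) (U : Finset ℕ) :
    colProd m U = colFactor k U * (colFactor j U *
      ∏ i ∈ ((range m).erase k).erase j, colFactor i U) := by
  rw [colProd_eq_mul hk, mul_prod_erase _ (fun i => colFactor i U) (mem_erase.mpr ⟨hjk, mem_range.mpr hj⟩)]

lemma restCard_image_swap_of_le {n m a b : ℕ} (ha : a ≤ 2 * m) (hb : b ≤ 2 * m) (U : Finset ℕ) :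
    restCard n m (U.image (Equiv.swap a b)) = restCard n m U := by
  unfold restCard
  congr 1
  ext x
  simp only [mem_inter, mem_Icc]
  refine and_congr_left fun hx => ?_
  rw [mem_image_swap, Equiv.swap_apply_of_ne_of_ne (by omega) (by omega)]

lemma restCard_image_swap_of_mem {n m a b : ℕ} (ha : a ∈ Icc (2 * m + 1) n)
    (hb : b ∈ Icc (2 * m + 1) n) (U : Finset ℕ) :
    restCard n m (U.image (Equiv.swap a b)) = restCard n m U := by
  have hI : ∀ x, Equiv.swap a b x ∈ Icc (2 * m + 1) n ↔ x ∈ Icc (2 * m + 1) n := by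
    intro x
    rw [Equiv.swap_apply_def]
    split_ifs with h1 h2
    · simp only [h1, ha, hb]
    · simp only [h2, ha, hb]
    · rfl
  unfold restCard
  rw [← card_image_of_injective (U ∩ Icc (2 * m + 1) n) (Equiv.swap a b).injective]
  congr 1
  ext x
  rw [mem_inter, mem_image_swap, mem_image_swap, mem_inter, hI]

lemma restCard_eq_add {n m r : ℕ} (hr : r ∈ Icc (2 * m + 1) n) (U : Finset ℕ) :
    restCard n m U = (U ∩ (Icc (2 * m + 1) n).erase r).card + if r ∈ U then 1 else 0 := by
  unfold restCard
  split_ifs with h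
  · rw [inter_erase, card_erase_add_one (mem_inter.mpr ⟨h, hr⟩)]
  · rw [add_zero, inter_erase, erase_eq_of_notMem fun h' => h (mem_inter.mp h').1]

/-- A function of the shape shared by `gT` and `fT`. -/
noncomputable def colVec (n m : ℕ) (h : ℕ → ℝ) (U : Finset ℕ) : ℝ :=
  colProd m U * h (restCard n m U)

section ColVec

variable (n m : ℕ) (h : ℕ → ℝ) (U : Finset ℕ)

lemma colVec_swap_column {j : ℕ} (hj : j < m) :
    colVec n m h (U.image (Equiv.swap (2 * j + 1) (2 * j + 2))) = -colVec n m h U := by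
  rw [colVec, colVec, restCard_image_swap_of_le (by omega) (by omega), colProd_eq_mul hj,
    colProd_eq_mul hj U, prod_congr rfl fun i hi => colFactor_image_swap_of_ne _ _ _ _ _]
  · rw [colFactor, memInd_image_swap_left, memInd_image_swap_right, colFactor]
    ring
  all_goals
    intro i hi
    have := (mem_erase.mp hi).1
    omega

lemma colVec_swap_pair_of_le {k j e : ℕ} (hk : k < m) (hj : j < m) (hjk : j ≠ k)
    (he : e = 2 * j + 1 ∨ e = 2 * j + 2) :
    colVec n m h (U.image (Equiv.swap (2 * k + 1) e)) +
      colVec n m h (U.image (Equiv.swap (2 * k + 2) e)) = colVec n m h U := by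
  have hprod : ∀ b, b = 2 * k + 1 ∨ b = 2 * k + 2 →
      ∏ i ∈ ((range m).erase k).erase j, colFactor i (U.image (Equiv.swap b e)) =
        ∏ i ∈ ((range m).erase k).erase j, colFactor i U := by
    intro b hb
    refine prod_congr rfl fun i hi => ?_
    have h1 := (mem_erase.mp hi).1
    have h2 := (mem_erase.mp (mem_erase.mp hi).2).1
    exact colFactor_image_swap_of_ne (by omega) (by omega) (by omega) (by omega) U
  simp only [colVec]
  rw [restCard_image_swap_of_le (by omega) (by omega),
    restCard_image_swap_of_le (by omega) (by omega), colProd_eq_mul_mul hk hj hjk,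
    colProd_eq_mul_mul hk hj hjk, colProd_eq_mul_mul hk hj hjk, hprod _ (Or.inl rfl),
    hprod _ (Or.inr rfl)]
  simp only [colFactor]
  rcases he with rfl | rfl
  · rw [memInd_image_swap_left, memInd_image_swap_left, memInd_image_swap_right,
      memInd_image_swap_right, memInd_image_swap_of_ne (by omega) (by omega),
      memInd_image_swap_of_ne (by omega) (by omega), memInd_image_swap_of_ne (by omega) (by omega),
      memInd_image_swap_of_ne (by omega) (by omega)]
    ring
  · rw [memInd_image_swap_left, memInd_image_swap_left, memInd_image_swap_right,
      memInd_image_swap_right, memInd_image_swap_of_ne (by omega) (by omega),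
      memInd_image_swap_of_ne (by omega) (by omega), memInd_image_swap_of_ne (by omega) (by omega),
      memInd_image_swap_of_ne (by omega) (by omega)]
    ring

lemma colVec_swap_pair_of_gt {k r : ℕ} (hk : k < m) (hr : r ∈ Icc (2 * m + 1) n) :
    colVec n m h (U.image (Equiv.swap (2 * k + 1) r)) +
      colVec n m h (U.image (Equiv.swap (2 * k + 2) r)) = colVec n m h U := by
  have hr' := mem_Icc.mp hr
  have hprod : ∀ b, b = 2 * k + 1 ∨ b = 2 * k + 2 →
      ∏ i ∈ (range m).erase k, colFactor i (U.image (Equiv.swap b r)) =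
        ∏ i ∈ (range m).erase k, colFactor i U := by
    intro b hb
    refine prod_congr rfl fun i hi => ?_
    have h1 := (mem_erase.mp hi).1
    have h2 := mem_range.mp (mem_erase.mp hi).2
    exact colFactor_image_swap_of_ne (by omega) (by omega) (by omega) (by omega) U
  have hcard : ∀ b, b = 2 * k + 1 ∨ b = 2 * k + 2 →
      U.image (Equiv.swap b r) ∩ (Icc (2 * m + 1) n).erase r =
        U ∩ (Icc (2 * m + 1) n).erase r := by
    intro b hb
    ext x
    simp only [mem_inter, mem_erase, mem_Icc]
    refine and_congr_left fun hx => ?_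
    rw [mem_image_swap, Equiv.swap_apply_of_ne_of_ne (by omega) (by omega)]
  simp only [colVec]
  rw [restCard_eq_add hr, restCard_eq_add hr, restCard_eq_add hr U, colProd_eq_mul hk,
    colProd_eq_mul hk, colProd_eq_mul hk U, hprod _ (Or.inl rfl), hprod _ (Or.inr rfl),
    hcard _ (Or.inl rfl), hcard _ (Or.inr rfl)]
  simp only [colFactor, mem_image_swap, Equiv.swap_apply_right]
  rw [memInd_image_swap_left, memInd_image_swap_left,
    memInd_image_swap_of_ne (by omega) (by omega), memInd_image_swap_of_ne (by omega) (by omega)]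
  simp only [memInd]
  split_ifs <;> ring

lemma sum_Icc_two_mul (j : ℕ) (F : ℕ → ℝ) :
    ∑ i ∈ Icc 1 (2 * j), F i = ∑ k ∈ range j, (F (2 * k + 1) + F (2 * k + 2)) := by
  induction j with
  | zero => simp
  | succ j ih =>
    rw [sum_range_succ, ← ih, mul_add, mul_one, sum_Icc_succ_top (by omega),
      sum_Icc_succ_top (by omega)]
    ring

lemma card_filter_evenRow {j : ℕ} (hj : j ≤ m) {r : ℕ} (hr : 2 * j < r)
    (hr' : j = m ∨ r ≤ 2 * j + 2) : ((evenRow m).filter (· < r)).card = j := by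
  rw [← card_evenRow j]
  congr 1
  ext x
  simp only [mem_filter, mem_evenRow]
  constructor
  · rintro ⟨⟨i, hi, rfl⟩, hx⟩
    exact ⟨i, by omega, rfl⟩
  · rintro ⟨i, hi, rfl⟩
    exact ⟨⟨i, by omega, rfl⟩, by omega⟩

lemma isMurphyEigen_colVec : IsMurphyEigen n (evenRow m) (colVec n m h) := by
  intro r hr
  have hr' := mem_Icc.mp hr
  funext U
  rw [Pi.smul_apply, smul_eq_mul, murphy]
  rcases Nat.lt_or_ge (2 * m) r with hm | hm
  · have hrI : r ∈ Icc (2 * m + 1) n := mem_Icc.mpr ⟨hm, hr'.2⟩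
    obtain ⟨d, rfl⟩ := Nat.exists_eq_add_of_lt hm
    have hsplit : Icc 1 (2 * m + d + 1 - 1) = Icc 1 (2 * m) ∪ Icc (2 * m + 1) (2 * m + d) := by
      ext x
      simp only [mem_union, mem_Icc]
      omega
    have hdisj : Disjoint (Icc 1 (2 * m)) (Icc (2 * m + 1) (2 * m + d)) := by
      rw [disjoint_left]
      intro x hx hx'
      simp only [mem_Icc] at hx hx'
      omega
    rw [hsplit, sum_union hdisj, sum_Icc_two_mul,
      sum_congr rfl fun k hk => colVec_swap_pair_of_gt n m h U (mem_range.mp hk) hrI]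
    have h2 : ∀ i ∈ Icc (2 * m + 1) (2 * m + d),
        colVec n m h (U.image (Equiv.swap i (2 * m + d + 1))) = colVec n m h U := by
      intro i hi
      have hi' := mem_Icc.mp hi
      have h3 : restCard n m (U.image (Equiv.swap i (2 * m + d + 1))) = restCard n m U :=
        restCard_image_swap_of_mem (mem_Icc.mpr ⟨hi'.1, by omega⟩) hrI U
      have h4 : colProd m (U.image (Equiv.swap i (2 * m + d + 1))) = colProd m U :=
        prod_congr rfl fun k hk => by
          have := mem_range.mp hk
          exact colFactor_image_swap_of_ne (by omega) (by omega) (by omega) (by omega) U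
      rw [colVec, h3, h4, colVec]
    have hnot : 2 * m + d + 1 ∉ evenRow m := by
      rw [mem_evenRow]
      rintro ⟨j, hj, hj'⟩
      omega
    rw [sum_congr rfl h2, tabContent, if_neg hnot,
      card_filter_evenRow m le_rfl hm (Or.inl rfl)]
    simp only [sum_const, card_range, Nat.card_Icc, nsmul_eq_mul]
    rw [show 2 * m + d + 1 - (2 * m + 1) = d by omega]
    push_cast
    ring
  · obtain ⟨j, hj⟩ : ∃ j, r = 2 * j + 1 ∨ r = 2 * j + 2 := ⟨(r - 1) / 2, by omega⟩
    have hjm : j < m := by omega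
    have hpairs : ∑ i ∈ Icc 1 (2 * j), colVec n m h (U.image (Equiv.swap i r)) =
        j * colVec n m h U := by
      rw [sum_Icc_two_mul, sum_congr rfl fun k hk => colVec_swap_pair_of_le n m h U
        (lt_trans (mem_range.mp hk) hjm) hjm (mem_range.mp hk).ne' hj]
      simp
    have hfil := card_filter_evenRow m hjm.le (r := r) (by omega) (by omega)
    rw [tabContent, hfil]
    rcases hj with rfl | rfl
    · have hnot : 2 * j + 1 ∉ evenRow m := by
        rw [mem_evenRow]
        rintro ⟨i, hi, hi'⟩
        omega
      rw [if_neg hnot, Nat.add_sub_cancel, hpairs]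
      push_cast
      ring
    · rw [if_pos (mem_evenRow.mpr ⟨j, hjm, by ring⟩), show 2 * j + 2 - 1 = 2 * j + 1 by omega,
        sum_Icc_succ_top (by omega), hpairs, colVec_swap_column n m h U hjm]
      ring

end ColVec

lemma gT_eq (n m i : ℕ) (U : Finset ℕ) :
    gT n m i U = colProd m U * if restCard n m U = i then 1 else 0 := by
  have hsign : (-1 : ℝ) ^ ((U ∩ (range m).image (fun r => 2 * r + 1)).card) =
      ∏ r ∈ range m, if 2 * r + 1 ∈ U then (-1 : ℝ) else 1 := by
    rw [prod_ite, prod_const, prod_const_one, mul_one]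
    congr 1
    rw [← card_image_of_injective ((range m).filter fun r => 2 * r + 1 ∈ U)
      (f := fun r => 2 * r + 1) fun a b hab => by simpa using hab]
    congr 1
    ext x
    simp only [mem_inter, mem_image, mem_filter]
    constructor
    · rintro ⟨hx, r, hr, rfl⟩
      exact ⟨r, ⟨hr, hx⟩, rfl⟩
    · rintro ⟨r, ⟨hr, hx⟩, rfl⟩
      exact ⟨hx, r, hr, rfl⟩
  unfold gT
  by_cases hU : ∀ r ∈ Icc 1 m, ((2 * r - 1 ∈ U) ↔ ¬(2 * r ∈ U))
  · have hprod : colProd m U = ∏ r ∈ range m, if 2 * r + 1 ∈ U then (-1 : ℝ) else 1 := by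
      refine prod_congr rfl fun r hr => ?_
      have := hU (r + 1) (mem_Icc.mpr ⟨by omega, mem_range.mp hr⟩)
      rw [show 2 * (r + 1) - 1 = 2 * r + 1 by omega, show 2 * (r + 1) = 2 * r + 2 by ring] at this
      simp only [colFactor, memInd]
      by_cases h : 2 * r + 2 ∈ U
      · simp [h, this]
      · simp [h, this.mpr h]
    rw [hsign, hprod]
    by_cases hc : restCard n m U = i
    · rw [if_pos ⟨hU, hc⟩, if_pos hc, mul_one]
    · rw [if_neg fun h => hc h.2, if_neg hc, mul_zero]
  · rw [if_neg fun h => hU h.1]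
    push Not at hU
    obtain ⟨r, hr, hrU⟩ := hU
    have hr' := mem_Icc.mp hr
    obtain ⟨s, rfl⟩ := Nat.exists_eq_add_of_le' hr'.1
    rw [show 2 * (s + 1) - 1 = 2 * s + 1 by omega, show 2 * (s + 1) = 2 * s + 2 by ring] at hrU
    have : colFactor s U = 0 := by
      simp only [colFactor, memInd]
      by_cases h : 2 * s + 1 ∈ U <;> by_cases h' : 2 * s + 2 ∈ U <;> simp_all
    rw [colProd_eq_mul (by omega : s < m), this]
    simp

lemma restCard_le (n m : ℕ) (U : Finset ℕ) : restCard n m U ≤ n - 2 * m := by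
  refine (card_le_card inter_subset_right).trans ?_
  rw [Nat.card_Icc]
  omega

lemma fT_eq_colVec (n m l : ℕ) : fT n m l = colVec n m (Tcoef n m l) := by
  funext U
  simp only [fT, gT_eq, mul_ite, mul_one, mul_zero]
  rw [sum_ite_eq, if_pos (mem_range.mpr (Nat.lt_succ_of_le (restCard_le n m U))), mul_comm]
  rfl

lemma card_eq_of_colProd_ne_zero {m : ℕ} {V : Finset ℕ} (hV : V ⊆ Icc 1 (2 * m))
    (h : colProd m V ≠ 0) : V.card = m := by
  have h1 : (V.card : ℝ) = ∑ i ∈ Icc 1 (2 * m), memInd V i := by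
    simp only [memInd]
    rw [sum_boole, filter_mem_eq_inter, inter_eq_right.mpr hV]
  have h2 : ∀ k ∈ range m, memInd V (2 * k + 1) + memInd V (2 * k + 2) = 1 := by
    intro k hk
    have hk' := prod_ne_zero_iff.mp h k hk
    unfold colFactor at hk'
    rcases memInd_eq_zero_or_one V (2 * k + 1) with e1 | e1 <;>
      rcases memInd_eq_zero_or_one V (2 * k + 2) with e2 | e2 <;>
      simp [e1, e2] at hk' ⊢
  rw [sum_Icc_two_mul, sum_congr rfl h2] at h1
  simpa using h1

lemma colProd_evenRow (m : ℕ) : colProd m (evenRow m) = 1 := by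
  refine prod_eq_one fun j hj => ?_
  have h1 : 2 * j + 2 ∈ evenRow m := mem_evenRow.mpr ⟨j, mem_range.mp hj, by ring⟩
  have h2 : 2 * j + 1 ∉ evenRow m := by
    rw [mem_evenRow]
    rintro ⟨i, _, hi⟩
    omega
  simp [colFactor, memInd, h1, h2]

lemma sum_powerset_union_of_disjoint {A B : Finset ℕ} (h : Disjoint A B) (F : Finset ℕ → ℝ) :
    ∑ U ∈ (A ∪ B).powerset, F U = ∑ V ∈ A.powerset, ∑ W ∈ B.powerset, F (V ∪ W) := by
  rw [← sum_product']
  refine sum_nbij' (fun U => (U ∩ A, U ∩ B)) (fun p => p.1 ∪ p.2) ?_ ?_ ?_ ?_ ?_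
  · intro U _
    simp [inter_subset_right]
  · rintro ⟨V, W⟩ hp
    simp only [mem_product, mem_powerset] at hp ⊢
    exact union_subset_union hp.1 hp.2
  · intro U hU
    simp only
    rw [← inter_union_distrib_left, inter_eq_left.mpr (mem_powerset.mp hU)]
  · rintro ⟨V, W⟩ hp
    simp only [mem_product, mem_powerset] at hp
    have h1 : W ∩ A = ∅ := disjoint_iff_inter_eq_empty.mp (h.symm.mono_left hp.2)
    have h2 : V ∩ B = ∅ := disjoint_iff_inter_eq_empty.mp (h.mono_left hp.1)
    simp only [union_inter_distrib_right, h1, h2, inter_eq_left.mpr hp.1, inter_eq_left.mpr hp.2,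
      union_empty, empty_union]
  · intro U hU
    simp only
    rw [← inter_union_distrib_left, inter_eq_left.mpr (mem_powerset.mp hU)]

lemma innerPi_colVec (N m : ℕ) : ∃ c : ℝ, 0 < c ∧ ∀ h h' : ℕ → ℝ,
    innerPi (N + 2 * m) (colVec (N + 2 * m) m h) (colVec (N + 2 * m) m h') =
      c * ∑ i ∈ range (N + 1), (N.choose i : ℝ) / ((N + 2 * m).choose (m + i)) * h i * h' i := by
  set n := N + 2 * m with hn
  have hdisj : Disjoint (Icc 1 (2 * m)) (Icc (2 * m + 1) n) := by
    rw [disjoint_left]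
    intro x hx hx'
    simp only [mem_Icc] at hx hx'
    omega
  have hun : Icc 1 n = Icc 1 (2 * m) ∪ Icc (2 * m + 1) n := by
    ext x
    simp only [mem_union, mem_Icc]
    omega
  refine ⟨(∑ V ∈ (Icc 1 (2 * m)).powerset, colProd m V ^ 2) * (1 / (n + 1)), ?_,
    fun h h' => ?_⟩
  · refine mul_pos (sum_pos' (fun V _ => sq_nonneg _) ⟨evenRow m, ?_, ?_⟩) (by positivity)
    · rw [mem_powerset]
      intro x hx
      obtain ⟨j, hj, rfl⟩ := mem_evenRow.mp hx
      exact mem_Icc.mpr ⟨by omega, by omega⟩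
    · rw [colProd_evenRow]
      norm_num
  · rw [innerPi, hun, sum_powerset_union_of_disjoint hdisj, mul_assoc, sum_mul]
    refine sum_congr rfl fun V hV => ?_
    have hV' := mem_powerset.mp hV
    have hterm : ∀ W ∈ (Icc (2 * m + 1) n).powerset,
        colVec n m h (V ∪ W) * colVec n m h' (V ∪ W) * piDist n (V ∪ W) =
          colProd m V ^ 2 * (1 / (n + 1)) *
            (h W.card * h' W.card / (n.choose (m + W.card))) := by
      intro W hW
      have hW' := mem_powerset.mp hW
      have e1 : restCard n m (V ∪ W) = W.card := by
        rw [restCard, union_inter_distrib_right, disjoint_iff_inter_eq_empty.mp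
          (hdisj.mono_left hV'), empty_union, inter_eq_left.mpr hW']
      have e2 : colProd m (V ∪ W) = colProd m V := by
        have hnot : ∀ x ≤ 2 * m, x ∉ W := fun x hx hxW => by
          have := mem_Icc.mp (hW' hxW)
          omega
        refine prod_congr rfl fun j hj => ?_
        have := mem_range.mp hj
        simp only [colFactor, memInd, mem_union, hnot (2 * j + 2) (by omega),
          hnot (2 * j + 1) (by omega), or_false]
      rw [colVec, colVec, e1, e2]
      by_cases hz : colProd m V = 0
      · simp [hz]
      · rw [piDist, card_union_of_disjoint (hdisj.mono hV' hW'),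
          card_eq_of_colProd_ne_zero hV' hz]
        simp only [mul_inv, div_eq_mul_inv]
        ring
    rw [sum_congr rfl hterm, ← mul_sum, sum_powerset_apply_card
      (fun i => h i * h' i / (n.choose (m + i) : ℝ)), Nat.card_Icc,
      show n + 1 - (2 * m + 1) = N by omega, mul_assoc]
    congr 2
    refine sum_congr rfl fun i _ => ?_
    rw [nsmul_eq_mul]
    ring

lemma innerPi_fT_of_ne {n m l l' : ℕ} (hm : 2 * m ≤ n) (h : l' ≠ l) :
    innerPi n (fT n m l) (fT n m l') = 0 := by
  obtain ⟨N, rfl⟩ := Nat.exists_eq_add_of_le' hm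
  obtain ⟨c, _, hc⟩ := innerPi_colVec N m
  rw [fT_eq_colVec, fT_eq_colVec, hc, sum_Tcoef_mul_Tcoef N m l l' h, mul_zero]

lemma innerPi_fT_self_pos {n m l : ℕ} (hm : 2 * m ≤ n) (hl : l ≤ n - 2 * m) :
    0 < innerPi n (fT n m l) (fT n m l) := by
  obtain ⟨N, rfl⟩ := Nat.exists_eq_add_of_le' hm
  obtain ⟨c, hc0, hc⟩ := innerPi_colVec N m
  rw [fT_eq_colVec, hc]
  refine mul_pos hc0 (sum_pos' (fun i _ => ?_) ⟨0, by simp, ?_⟩)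
  · rw [mul_assoc]
    exact mul_nonneg (by positivity) (mul_self_nonneg _)
  · have h1 := Tcoef_zero_ne_zero N m l (by omega)
    have h2 : 0 < (N + 2 * m).choose (m + 0) := Nat.choose_pos (by omega)
    rw [mul_assoc]
    exact mul_pos (by simpa using h2) (mul_self_pos.mpr h1)

/-! ### The vectors `fQvec` -/

lemma fQvec_eigen_and_inner {n : ℕ} {Q : List ℕ} (hQ : IsSYT n Q) :
    (∀ l, IsMurphyEigen n Q.toFinset (fQvec n Q l)) ∧
    ∃ γ : ℝ, 0 < γ ∧ ∀ l l', innerPi n (fQvec n Q l) (fQvec n Q l') =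
      γ * innerPi n (fT n Q.length l) (fT n Q.length l') := by
  obtain ⟨he, γ, hγ, hi⟩ := tauQAux_eigen_and_inner (n := n) Q 0 hQ.pairwise hQ.2.1
    fun i hi => by simpa using hQ.2.2 i hi
  have hT : ∀ l, IsMurphyEigen n (evenRow (0 + Q.length)) (fT n Q.length l) := fun l => by
    rw [zero_add, fT_eq_colVec]
    exact isMurphyEigen_colVec _ _ _
  refine ⟨fun l => ?_, γ, hγ, fun l l' => hi _ _ (hT l) (hT l')⟩
  have := he _ (hT l)
  rwa [show evenRow 0 = ∅ from rfl, empty_union] at this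

lemma innerPi_fQvec_of_ne {n : ℕ} {Q₁ Q₂ : List ℕ} {l₁ l₂ : ℕ} (h₁ : IsSYT n Q₁)
    (h₂ : IsSYT n Q₂) (hlen : 2 * Q₁.length ≤ n) (hne : (Q₁, l₁) ≠ (Q₂, l₂)) :
    innerPi n (fQvec n Q₁ l₁) (fQvec n Q₂ l₂) = 0 := by
  by_cases hQ : Q₁ = Q₂
  · subst hQ
    obtain ⟨_, γ, _, hi⟩ := fQvec_eigen_and_inner h₁
    rw [hi, innerPi_fT_of_ne hlen fun h => hne (by rw [h]), mul_zero]
  · obtain ⟨r, hr, hne'⟩ := exists_tabContent_ne h₁.subset_Icc h₂.subset_Icc h₁.ballot h₂.ballot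
      fun h => hQ (h₁.toFinset_injective h₂ h)
    exact ((fQvec_eigen_and_inner h₁).1 l₁).innerPi_eq_zero ((fQvec_eigen_and_inner h₂).1 l₂)
      hr hne'

lemma innerPi_fQvec_self_pos {n : ℕ} {Q : List ℕ} {l : ℕ} (hQ : IsSYT n Q)
    (hlen : 2 * Q.length ≤ n) (hl : l ≤ n - 2 * Q.length) :
    0 < innerPi n (fQvec n Q l) (fQvec n Q l) := by
  obtain ⟨_, γ, hγ, hi⟩ := fQvec_eigen_and_inner hQ
  rw [hi]
  exact mul_pos hγ (innerPi_fT_self_pos hlen hl)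

/-! ### Counting standard Young tableaux -/

/-- The second rows of the standard Young tableaux with `n` boxes and at most two rows. -/
noncomputable def twoRowSYT : ℕ → Finset (List ℕ)
  | 0 => {[]}
  | n + 1 => twoRowSYT n ∪
      ((twoRowSYT n).filter fun Q => 2 * Q.length + 2 ≤ n + 1).image fun Q => Q ++ [n + 1]

lemma isSYT_of_mem_twoRowSYT {n : ℕ} {Q : List ℕ} (h : Q ∈ twoRowSYT n) :
    IsSYT n Q ∧ 2 * Q.length ≤ n := by
  induction n generalizing Q with
  | zero =>
    rw [twoRowSYT, mem_singleton] at h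
    subst h
    exact ⟨⟨List.IsChain.nil, by simp, by simp⟩, by simp⟩
  | succ n ih =>
    rw [twoRowSYT, mem_union] at h
    rcases h with h | h
    · obtain ⟨⟨h1, h2, h3⟩, h4⟩ := ih h
      exact ⟨⟨h1, fun x hx => (h2 x hx).trans n.le_succ, h3⟩, h4.trans n.le_succ⟩
    · obtain ⟨P, hP, rfl⟩ := mem_image.mp h
      obtain ⟨hP, hlen⟩ := mem_filter.mp hP
      obtain ⟨hS, _⟩ := ih hP
      refine ⟨⟨List.isChain_iff_pairwise.mpr (List.pairwise_append.mpr
        ⟨hS.pairwise, List.pairwise_singleton _ _, ?_⟩), ?_, ?_⟩, ?_⟩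
      · intro a ha b hb
        rw [List.mem_singleton.mp hb]
        exact Nat.lt_succ_of_le (hS.2.1 a ha)
      · intro x hx
        rcases List.mem_append.mp hx with hx | hx
        · exact (hS.2.1 x hx).trans n.le_succ
        · exact (List.mem_singleton.mp hx).le
      · intro r hr
        rw [List.length_append, List.length_singleton] at hr
        rcases Nat.lt_succ_iff_lt_or_eq.mp hr with hr | rfl
        · rw [List.getD_append _ _ _ _ hr]
          exact hS.2.2 r hr
        · rw [List.getD_append_right _ _ _ _ le_rfl, Nat.sub_self, List.getD_cons_zero]
          omega
      · rw [List.length_append, List.length_singleton]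
        omega

lemma sum_twoRowSYT (n : ℕ) : ∑ Q ∈ twoRowSYT n, (n - 2 * Q.length + 1) = 2 ^ n := by
  induction n with
  | zero => simp [twoRowSYT]
  | succ n ih =>
    have hdisj : Disjoint (twoRowSYT n)
        (((twoRowSYT n).filter fun Q => 2 * Q.length + 2 ≤ n + 1).image fun Q => Q ++ [n + 1]) := by
      rw [disjoint_left]
      intro Q hQ hQ'
      obtain ⟨P, _, rfl⟩ := mem_image.mp hQ'
      have := (isSYT_of_mem_twoRowSYT hQ).1.2.1 (n + 1) (by simp)
      omega
    rw [twoRowSYT, sum_union hdisj, sum_image fun P _ P' _ h => List.append_cancel_right h,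
      sum_filter, ← sum_add_distrib, pow_succ, ← ih, sum_mul]
    refine sum_congr rfl fun Q hQ => ?_
    have := (isSYT_of_mem_twoRowSYT hQ).2
    rw [List.length_append, List.length_singleton]
    split_ifs <;> omega

lemma linearIndependent_of_innerPi {ι : Type*} {n : ℕ} (f : ι → Finset ℕ → ℝ)
    (horth : ∀ i j, i ≠ j → innerPi n (f i) (f j) = 0) (hpos : ∀ i, innerPi n (f i) (f i) ≠ 0) :
    LinearIndependent ℝ fun i => fun U : ↥((Icc 1 n).powerset) => f i U.1 := by
  rw [linearIndependent_iff']
  intro s g hg j hj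
  have h0 : ∑ i ∈ s, g i * innerPi n (f i) (f j) = 0 := by
    simp only [innerPi, mul_sum]
    rw [sum_comm]
    refine sum_eq_zero fun U hU => ?_
    have hU' := congrFun hg ⟨U, hU⟩
    simp only [Finset.sum_apply, Pi.smul_apply, smul_eq_mul, Pi.zero_apply] at hU'
    calc ∑ i ∈ s, g i * (f i U * f j U * piDist n U)
        = (∑ i ∈ s, g i * f i U) * (f j U * piDist n U) := by
          rw [sum_mul]
          exact sum_congr rfl fun _ _ => by ring
      _ = 0 := by rw [hU', zero_mul]
  rw [sum_eq_single_of_mem j hj fun i _ hij => by rw [horth i j hij, mul_zero]] at h0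
  exact (mul_eq_zero.mp h0).resolve_right (hpos j)

/-- The family f_Q^{m,ℓ} (over all valid triples) is pairwise orthogonal with
respect to ⟨·,·⟩_π, each member is nonzero, and consequently it is an orthogonal basis of
the 2^n-dimensional space of functions C_2^n → ℝ (it spans the whole space). -/
theorem fQ_orthogonal_basis (n : ℕ) :
    (∀ Q₁ ℓ₁ Q₂ ℓ₂, IsSYT n Q₁ → IsSYT n Q₂ → 2 * Q₁.length ≤ n → 2 * Q₂.length ≤ n →
      ℓ₁ ≤ n - 2 * Q₁.length → ℓ₂ ≤ n - 2 * Q₂.length → (Q₁, ℓ₁) ≠ (Q₂, ℓ₂) →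
      innerPi n (fQvec n Q₁ ℓ₁) (fQvec n Q₂ ℓ₂) = 0) ∧
    (∀ Q ℓ, IsSYT n Q → 2 * Q.length ≤ n → ℓ ≤ n - 2 * Q.length →
      ∃ U ⊆ Finset.Icc 1 n, fQvec n Q ℓ U ≠ 0) ∧
    Submodule.span ℝ
      {g : (↥((Finset.Icc 1 n).powerset) → ℝ) |
        ∃ Q ℓ, IsSYT n Q ∧ 2 * Q.length ≤ n ∧ ℓ ≤ n - 2 * Q.length ∧
          g = fun U => fQvec n Q ℓ U.1} = ⊤ := by
  refine ⟨fun Q₁ ℓ₁ Q₂ ℓ₂ h₁ h₂ hlen _ _ _ hne => innerPi_fQvec_of_ne h₁ h₂ hlen hne, ?_, ?_⟩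
  · intro Q ℓ hQ hlen hℓ
    by_contra! h
    refine (innerPi_fQvec_self_pos hQ hlen hℓ).ne' (sum_eq_zero fun U hU => ?_)
    rw [h U (mem_powerset.mp hU), zero_mul, zero_mul]
  · have hli : LinearIndependent ℝ
        fun i : (Σ Q : ↥(twoRowSYT n), Fin (n - 2 * Q.1.length + 1)) =>
          fun U : ↥((Icc 1 n).powerset) => fQvec n i.1.1 i.2 U.1 := by
      refine linearIndependent_of_innerPi
        (fun i : (Σ Q : ↥(twoRowSYT n), Fin (n - 2 * Q.1.length + 1)) => fQvec n i.1.1 i.2) ?_ ?_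
      · rintro ⟨⟨Q₁, h₁⟩, l₁⟩ ⟨⟨Q₂, h₂⟩, l₂⟩ hne
        obtain ⟨hS₁, hlen₁⟩ := isSYT_of_mem_twoRowSYT h₁
        refine innerPi_fQvec_of_ne hS₁ (isSYT_of_mem_twoRowSYT h₂).1 hlen₁ fun h => hne ?_
        obtain ⟨rfl, hl⟩ := Prod.mk.inj h
        exact congrArg _ (Fin.ext hl)
      · rintro ⟨⟨Q, h⟩, l⟩
        obtain ⟨hS, hlen⟩ := isSYT_of_mem_twoRowSYT h
        exact (innerPi_fQvec_self_pos hS hlen (Nat.lt_succ_iff.mp l.2)).ne'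
    rw [eq_top_iff, ← hli.span_eq_top_of_card_eq_finrank' ?_]
    · refine Submodule.span_mono ?_
      rintro _ ⟨⟨⟨Q, h⟩, l⟩, rfl⟩
      obtain ⟨hS, hlen⟩ := isSYT_of_mem_twoRowSYT h
      exact ⟨Q, l, hS, hlen, Nat.lt_succ_iff.mp l.2, rfl⟩
    · rw [Module.finrank_fintype_fun_eq_card, Fintype.card_coe, card_powerset, Nat.card_Icc,
        Nat.add_sub_cancel, Fintype.card_sigma]
      simp only [Fintype.card_fin]
      rw [sum_coe_sort (twoRowSYT n) fun Q => n - 2 * Q.length + 1, sum_twoRowSYT]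
end

section
/- For all integers n, m, ℓ with 0 ≤ m ≤ ⌊n/2⌋ and 0 ≤ ℓ ≤ n−2m: Σ_{i=0}^{n−2m} (T_{m,n}^{(ℓ)}(i))² · C(n−2m,i)/C(n,m+i) = [(2m+ℓ)! · (n−2m)! · (n+ℓ+1)!] / [(2m+2ℓ+1) · ((m+ℓ)!)² · ℓ! · n! · (n−2m−ℓ)!]. -/
open Finset

attribute [local instance] Classical.propDecidable

open Polynomial in
/-- The alternating binomial sum of a polynomial of degree at most `n` extracts its
`n`-th coefficient. -/
lemma sum_neg_one_pow_mul_choose_mul_eval {P : ℝ[X]} {n : ℕ} (hP : P.natDegree ≤ n) :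
    ∑ j ∈ range (n + 1), (-1 : ℝ) ^ j * n.choose j * P.eval (j : ℝ) =
      (-1) ^ n * n.factorial * P.coeff n := by
  have key : (fwdDiff (1 : ℝ))^[n] P.eval 0 = n.factorial * P.coeff n := by
    rcases hP.lt_or_eq with h | rfl
    · rw [fwdDiff_iter_eq_zero_of_degree_lt h, coeff_eq_zero_of_natDegree_lt h]
      simp
    · rw [fwdDiff_iter_degree_eq_factorial]
      simp [mul_comm]
  rw [mul_assoc, ← key, fwdDiff_iter_eq_sum_shift, mul_sum]
  refine sum_congr rfl fun j hj => ?_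
  have hj' : j ≤ n := mem_range_succ_iff.mp hj
  obtain ⟨c, rfl⟩ := Nat.exists_eq_add_of_le hj'
  have h : (-1 : ℝ) ^ c * (-1) ^ c = 1 := by rw [← mul_pow]; simp
  simp only [add_tsub_cancel_left, zsmul_eq_mul, nsmul_eq_mul, zero_add, mul_one]
  push_cast
  rw [pow_add]
  linear_combination (-(-1 : ℝ) ^ j * (j + c).choose j * P.eval (j : ℝ)) * h

open Polynomial in
/-- A linear functional vanishing on the first `d` members of a monic polynomial sequence is
determined, on polynomials of degree at most `d`, by the coefficient of degree `d`. -/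
lemma linearMap_eq_coeff_mul_of_monic (L : ℝ[X] →ₗ[ℝ] ℝ) {q : ℕ → ℝ[X]}
    (hq : ∀ k, (q k).Monic) (hdeg : ∀ k, (q k).natDegree = k) {d : ℕ}
    (hL : ∀ k < d, L (q k) = 0) {p : ℝ[X]} (hp : p.natDegree ≤ d) :
    L p = p.coeff d * L (q d) := by
  have hdeg' : ∀ k (p : ℝ[X]), p.degree < (k + 1 : ℕ) →
      (p - C (p.coeff k) * q k).degree < (k : ℕ) := by
    intro k p hp
    rw [degree_lt_iff_coeff_zero] at hp ⊢
    intro j hj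
    rcases hj.eq_or_lt with rfl | hj
    · have : (q k).coeff k = 1 := by simpa [hdeg k] using (hq k).coeff_natDegree
      simp [this]
    · have : (q k).coeff j = 0 := coeff_eq_zero_of_natDegree_lt (by rw [hdeg k]; exact hj)
      simp [this, hp j hj]
  have hzero : ∀ k ≤ d, ∀ p : ℝ[X], p.degree < (k : ℕ) → L p = 0 := by
    intro k
    induction k with
    | zero =>
      intro _ p hp
      have : p = 0 := by simpa using hp
      simp [this]
    | succ k ih =>
      intro hk p hp
      have h := ih (by omega) _ (hdeg' k p hp)
      rw [map_sub, C_mul', map_smul, hL k (by omega)] at h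
      simpa using h
  have h := hzero d le_rfl _ (hdeg' d p (by
    rw [degree_lt_iff_coeff_zero]
    exact fun j hj => coeff_eq_zero_of_natDegree_lt (by omega)))
  rw [map_sub, C_mul', map_smul, smul_eq_mul] at h
  linarith

lemma sum_antidiagonal_choose_mul_choose (p q d : ℕ) :
    ∑ x ∈ antidiagonal d, (p + x.1).choose p * (q + x.2).choose q =
      (p + q + 1 + d).choose (p + q + 1) := by
  have h : (PowerSeries.mk fun n => ((p + n).choose p : ℤ)) *
      (PowerSeries.mk fun n => ((q + n).choose q : ℤ)) =
      PowerSeries.mk fun n => ((p + q + 1 + n).choose (p + q + 1) : ℤ) := by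
    rw [← PowerSeries.mk_one_pow_eq_mk_choose_add, ← PowerSeries.mk_one_pow_eq_mk_choose_add,
      ← PowerSeries.mk_one_pow_eq_mk_choose_add, ← pow_add]
    congr 1
    omega
  have h' := congrArg (PowerSeries.coeff d) h
  simp only [PowerSeries.coeff_mul, PowerSeries.coeff_mk] at h'
  exact_mod_cast h'

lemma sum_range_choose_mul_choose (m k : ℕ) {N l j : ℕ} (hj : j ≤ l) (hl : l ≤ N) :
    ∑ i ∈ range (N + 1), (m + i + k).choose (m + j + k) * (m + (N - i)).choose (m + (l - j)) =
      (2 * m + N + k + 1).choose (2 * m + l + k + 1) := by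
  obtain ⟨b, rfl⟩ := Nat.exists_eq_add_of_le hj
  obtain ⟨d, rfl⟩ := Nat.exists_eq_add_of_le hl
  have hsub : Ico j (j + (d + 1)) ⊆ range (j + b + d + 1) := by
    intro i hi
    simp only [mem_Ico, mem_range] at *
    omega
  rw [← sum_subset hsub, sum_Ico_eq_sum_range]
  · have h := sum_antidiagonal_choose_mul_choose (m + j + k) (m + b) d
    rw [Nat.sum_antidiagonal_eq_sum_range_succ_mk] at h
    convert h using 1
    · rw [show j + (d + 1) - j = d.succ by omega]
      refine sum_congr rfl fun x hx => ?_
      have hx' : x < d + 1 := mem_range.mp hx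
      congr 2 <;> omega
    · congr 1 <;> omega
  · intro i hi hi'
    simp only [mem_Ico, mem_range] at *
    rcases lt_or_ge i j with h | h
    · rw [Nat.choose_eq_zero_of_lt (show m + i + k < m + j + k by omega), zero_mul]
    · rw [Nat.choose_eq_zero_of_lt
        (show m + (j + b + d - i) < m + (j + b - j) by omega), mul_zero]

lemma choose_mul_choose_mul_weight (m : ℕ) {N l i j : ℕ} (hj : j ≤ l) (hi : i ≤ N) :
    ((2 * m + l).choose (m + j) * i.choose j * (N - i).choose (l - j) : ℝ) *
        (N.choose i / (2 * m + N).choose (m + i)) =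
      ((2 * m + l).factorial * N.factorial / (l.factorial * (2 * m + N).factorial)) *
        (l.choose j * (m + i).choose (m + j) * (m + (N - i)).choose (m + (l - j))) := by
  rcases lt_or_ge i j with h | h
  · simp [Nat.choose_eq_zero_of_lt h, Nat.choose_eq_zero_of_lt (Nat.add_lt_add_left h m)]
  rcases lt_or_ge (N - i) (l - j) with h' | h'
  · simp [Nat.choose_eq_zero_of_lt h', Nat.choose_eq_zero_of_lt (Nat.add_lt_add_left h' m)]
  obtain ⟨b, rfl⟩ := Nat.exists_eq_add_of_le hj
  obtain ⟨a, rfl⟩ := Nat.exists_eq_add_of_le h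
  obtain ⟨c, rfl⟩ : ∃ c, N = j + a + (b + c) := ⟨N - (j + a) - b, by omega⟩
  rw [show j + b - j = b by omega, show j + a + (b + c) - (j + a) = b + c by omega,
    show 2 * m + (j + b) = (m + j) + (m + b) by ring,
    show 2 * m + (j + a + (b + c)) = (m + (j + a)) + (m + (b + c)) by ring,
    show (m + (j + a)).choose (m + j) = ((m + j) + a).choose (m + j) by rw [add_assoc],
    show (m + (b + c)).choose (m + b) = ((m + b) + c).choose (m + b) by rw [add_assoc]]
  simp only [Nat.cast_add_choose]
  rw [show m + j + a = m + (j + a) by ring, show m + b + c = m + (b + c) by ring]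
  have hf (n : ℕ) : (n.factorial : ℝ) ≠ 0 := by positivity
  field_simp [hf]

lemma choose_mul_ascFactorial (m i j k : ℕ) :
    (m + i).choose (m + j) * (m + i + 1).ascFactorial k =
      (m + i + k).choose (m + j + k) * (m + j + 1).ascFactorial k := by
  rcases lt_or_ge i j with h | h
  · rw [Nat.choose_eq_zero_of_lt (show m + i < m + j by omega),
      Nat.choose_eq_zero_of_lt (show m + i + k < m + j + k by omega), zero_mul, zero_mul]
  obtain ⟨a, rfl⟩ := Nat.exists_eq_add_of_le h
  have h1 := Nat.factorial_mul_ascFactorial (m + (j + a)) k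
  have h2 := Nat.factorial_mul_ascFactorial (m + j) k
  have h3 := Nat.add_choose_mul_factorial_mul_factorial (m + j) a
  have h4 := Nat.add_choose_mul_factorial_mul_factorial (m + j + k) a
  rw [← Nat.choose_symm_add, show m + j + a = m + (j + a) by ring] at h3
  rw [← Nat.choose_symm_add, show m + j + k + a = m + (j + a) + k by ring] at h4
  refine Nat.eq_of_mul_eq_mul_right
    (Nat.mul_pos (Nat.factorial_pos (m + j)) (Nat.factorial_pos a)) ?_
  calc _ = ((m + (j + a)).choose (m + j) * (m + j).factorial * a.factorial) *
        (m + (j + a) + 1).ascFactorial k := by ring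
    _ = (m + (j + a) + k).choose (m + j + k) * ((m + j).factorial *
        (m + j + 1).ascFactorial k) * a.factorial := by rw [h3, h1, h2, h4]
    _ = _ := by ring

lemma Tcoef_eq_sum_range (n m l i : ℕ) :
    Tcoef n m l i = ∑ j ∈ range (l + 1), (-1 : ℝ) ^ (m + j) *
      ((2 * m + l).choose (m + j) * i.choose j * (n - 2 * m - i).choose (l - j)) := by
  rw [Tcoef, ← sum_filter]
  have hsub : (range (i + 1)).filter (· ≤ l) ⊆ range (l + 1) := by
    intro j hj
    simp only [mem_filter, mem_range] at *
    omega
  rw [← sum_subset hsub]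
  · exact sum_congr rfl fun j _ => by ring
  · intro j hj hj'
    simp only [mem_filter, mem_range] at *
    rw [Nat.choose_eq_zero_of_lt (show i < j by omega)]
    simp

open Polynomial in
/-- The polynomial of degree at most `l` interpolating `Tcoef (2 * m + N) m l` on `{0, …, N}`. -/
noncomputable def TcoefPoly (N m l : ℕ) : ℝ[X] :=
  ∑ j ∈ range (l + 1), C ((-1 : ℝ) ^ (m + j) * (2 * m + l).choose (m + j) /
    (j.factorial * (l - j).factorial)) *
      (descPochhammer ℝ j * (descPochhammer ℝ (l - j)).comp (C (N : ℝ) - X))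

open Polynomial in
lemma eval_TcoefPoly {N m l i : ℕ} (hi : i ≤ N) :
    (TcoefPoly N m l).eval (i : ℝ) = Tcoef (2 * m + N) m l i := by
  rw [Tcoef_eq_sum_range, TcoefPoly, eval_finsetSum]
  refine sum_congr rfl fun j _ => ?_
  rw [add_tsub_cancel_left, Nat.cast_choose_eq_descPochhammer_div ℝ i,
    Nat.cast_choose_eq_descPochhammer_div ℝ (N - i), Nat.cast_sub hi]
  simp only [eval_mul, eval_C, eval_comp, eval_sub, eval_X]
  have hf (n : ℕ) : (n.factorial : ℝ) ≠ 0 := by positivity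
  field_simp [hf]

open Polynomial in
lemma natDegree_C_sub_X (a : ℝ) : (C a - X : ℝ[X]).natDegree = 1 := by
  rw [← neg_sub, natDegree_neg, natDegree_X_sub_C]

open Polynomial in
lemma natDegree_descPochhammer_mul_comp (N : ℝ) {l j : ℕ} (hj : j ≤ l) :
    (descPochhammer ℝ j * (descPochhammer ℝ (l - j)).comp (C N - X)).natDegree ≤ l := by
  refine natDegree_mul_le.trans ?_
  rw [natDegree_comp, descPochhammer_natDegree, descPochhammer_natDegree, natDegree_C_sub_X]
  omega

open Polynomial in
lemma coeff_descPochhammer_mul_comp (N : ℝ) {l j : ℕ} (hj : j ≤ l) :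
    (descPochhammer ℝ j * (descPochhammer ℝ (l - j)).comp (C N - X)).coeff l =
      (-1) ^ (l - j) := by
  have h1 : (descPochhammer ℝ j).coeff j = 1 := by
    simpa [descPochhammer_natDegree] using (monic_descPochhammer ℝ j).coeff_natDegree
  have h2 : ((descPochhammer ℝ (l - j)).comp (C N - X)).natDegree = l - j := by
    rw [natDegree_comp, descPochhammer_natDegree, natDegree_C_sub_X, mul_one]
  have h3 : ((descPochhammer ℝ (l - j)).comp (C N - X)).coeff (l - j) = (-1) ^ (l - j) := by
    have h : (C N - X : ℝ[X]).leadingCoeff = -1 := by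
      rw [← neg_sub, leadingCoeff_neg, leadingCoeff_X_sub_C]
    have := leadingCoeff_comp (p := descPochhammer ℝ (l - j)) (q := C N - X)
      (by rw [natDegree_C_sub_X]; exact one_ne_zero)
    rwa [leadingCoeff, h2, (monic_descPochhammer ℝ (l - j)).leadingCoeff, one_mul, h,
      descPochhammer_natDegree] at this
  have := coeff_mul_add_eq_of_natDegree_le (f := descPochhammer ℝ j)
    (g := (descPochhammer ℝ (l - j)).comp (C N - X))
    (descPochhammer_natDegree ℝ j).le h2.le
  rwa [h1, h3, one_mul, Nat.add_sub_cancel' hj] at this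

lemma natDegree_TcoefPoly_le (N m l : ℕ) : (TcoefPoly N m l).natDegree ≤ l :=
  Polynomial.natDegree_sum_le_of_forall_le _ _ fun _ hj =>
    (Polynomial.natDegree_C_mul_le _ _).trans
      (natDegree_descPochhammer_mul_comp _ (mem_range_succ_iff.mp hj))

lemma coeff_TcoefPoly (N m l : ℕ) :
    (TcoefPoly N m l).coeff l =
      (-1) ^ (m + l) * (2 * m + 2 * l).choose (m + l) / l.factorial := by
  have hv : ((2 * m + 2 * l).choose (m + l) : ℝ) =
      ∑ j ∈ range (l + 1), ((2 * m + l).choose (m + j) : ℝ) * l.choose j := by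
    have h := Nat.add_choose_eq l (2 * m + l) (m + l)
    rw [show l + (2 * m + l) = 2 * m + 2 * l by ring,
      Nat.sum_antidiagonal_eq_sum_range_succ_mk] at h
    have hsub : range (l + 1) ⊆ range (m + l).succ := range_subset_range.mpr (by omega)
    rw [h, ← sum_subset hsub]
    · push_cast
      rw [← sum_range_reflect]
      refine sum_congr rfl fun j hj => ?_
      have hj' : j ≤ l := mem_range_succ_iff.mp hj
      rw [show l + 1 - 1 - j = l - j by omega, Nat.choose_symm hj',
        show m + l - (l - j) = m + j by omega, mul_comm]
    · intro j _ hj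
      rw [Nat.choose_eq_zero_of_lt (by simpa using hj), zero_mul]
  rw [TcoefPoly, Polynomial.finsetSum_coeff, hv, mul_sum, sum_div]
  refine sum_congr rfl fun j hj => ?_
  have hj' : j ≤ l := mem_range_succ_iff.mp hj
  rw [Polynomial.coeff_C_mul, coeff_descPochhammer_mul_comp _ hj', Nat.cast_choose ℝ hj']
  obtain ⟨b, rfl⟩ := Nat.exists_eq_add_of_le hj'
  rw [add_tsub_cancel_left]
  have hf (n : ℕ) : (n.factorial : ℝ) ≠ 0 := by positivity
  field_simp [hf]
  ring

open Polynomial in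
/-- The Pochhammer polynomial `(X + m + 1)(X + m + 2)⋯(X + m + k)`. -/
noncomputable def shiftedAscPochhammer (m k : ℕ) : ℝ[X] :=
  (ascPochhammer ℝ k).comp (X + C ((m + 1 : ℕ) : ℝ))

lemma monic_shiftedAscPochhammer (m k : ℕ) : (shiftedAscPochhammer m k).Monic :=
  (monic_ascPochhammer ℝ k).comp_X_add_C _

lemma natDegree_shiftedAscPochhammer (m k : ℕ) : (shiftedAscPochhammer m k).natDegree = k := by
  rw [shiftedAscPochhammer, Polynomial.natDegree_comp, ascPochhammer_natDegree,
    Polynomial.natDegree_X_add_C, mul_one]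

lemma eval_shiftedAscPochhammer (m k i : ℕ) :
    (shiftedAscPochhammer m k).eval (i : ℝ) = (m + i + 1).ascFactorial k := by
  rw [← ascPochhammer_nat_eq_natCast_ascFactorial, shiftedAscPochhammer, Polynomial.eval_comp]
  congr 1
  simp
  ring

open Polynomial in
/-- The linear functional pairing a polynomial with `Tcoef (2 * m + N) m l` under the Hahn
weight. -/
noncomputable def TcoefPairing (N m l : ℕ) : ℝ[X] →ₗ[ℝ] ℝ :=
  ∑ i ∈ range (N + 1), (Tcoef (2 * m + N) m l i *
    ((N.choose i : ℝ) / (2 * m + N).choose (m + i))) • leval (i : ℝ)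

lemma TcoefPairing_apply (N m l : ℕ) (p : Polynomial ℝ) :
    TcoefPairing N m l p = ∑ i ∈ range (N + 1), Tcoef (2 * m + N) m l i *
      ((N.choose i : ℝ) / (2 * m + N).choose (m + i)) * p.eval (i : ℝ) := by
  simp [TcoefPairing, LinearMap.sum_apply]

lemma Tcoef_mul_weight (m l : ℕ) {N i : ℕ} (hi : i ≤ N) :
    Tcoef (2 * m + N) m l i * ((N.choose i : ℝ) / (2 * m + N).choose (m + i)) =
      (-1) ^ m * ((2 * m + l).factorial * N.factorial /
        (l.factorial * (2 * m + N).factorial)) *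
        ∑ j ∈ range (l + 1), (-1 : ℝ) ^ j * l.choose j *
          ((m + i).choose (m + j) * (m + (N - i)).choose (m + (l - j))) := by
  rw [Tcoef_eq_sum_range, sum_mul, mul_sum]
  refine sum_congr rfl fun j hj => ?_
  rw [add_tsub_cancel_left, mul_assoc,
    choose_mul_choose_mul_weight m (mem_range_succ_iff.mp hj) hi]
  ring

lemma TcoefPairing_shiftedAscPochhammer (m k : ℕ) {N l : ℕ} (hl : l ≤ N) (hk : k ≤ l) :
    TcoefPairing N m l (shiftedAscPochhammer m k) =
      (-1) ^ m * ((2 * m + l).factorial * N.factorial /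
        (l.factorial * (2 * m + N).factorial)) *
        (2 * m + N + k + 1).choose (2 * m + l + k + 1) *
        ((-1) ^ l * l.factorial * (shiftedAscPochhammer m k).coeff l) := by
  rw [← sum_neg_one_pow_mul_choose_mul_eval ((natDegree_shiftedAscPochhammer m k).le.trans hk),
    TcoefPairing_apply]
  have hterm : ∀ i ∈ range (N + 1), Tcoef (2 * m + N) m l i *
      ((N.choose i : ℝ) / (2 * m + N).choose (m + i)) *
        (shiftedAscPochhammer m k).eval (i : ℝ) =
      ∑ j ∈ range (l + 1), (-1) ^ m * ((2 * m + l).factorial * N.factorial /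
        (l.factorial * (2 * m + N).factorial)) * ((-1 : ℝ) ^ j * l.choose j *
          (shiftedAscPochhammer m k).eval (j : ℝ)) *
          ((m + i + k).choose (m + j + k) * (m + (N - i)).choose (m + (l - j)) : ℕ) := by
    intro i hi
    rw [Tcoef_mul_weight m l (mem_range_succ_iff.mp hi), mul_sum, sum_mul]
    refine sum_congr rfl fun j _ => ?_
    have h : ((m + i).choose (m + j) * (m + i + 1).ascFactorial k : ℝ) =
        (m + i + k).choose (m + j + k) * (m + j + 1).ascFactorial k :=
      mod_cast choose_mul_ascFactorial m i j k
    rw [eval_shiftedAscPochhammer, eval_shiftedAscPochhammer]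
    push_cast
    linear_combination ((-1) ^ m * ((2 * m + l).factorial * N.factorial /
        (l.factorial * (2 * m + N).factorial)) * ((-1 : ℝ) ^ j * l.choose j) *
        (m + (N - i)).choose (m + (l - j))) * h
  rw [sum_congr rfl hterm, sum_comm, mul_sum]
  refine sum_congr rfl fun j hj => ?_
  rw [← mul_sum, ← Nat.cast_sum, sum_range_choose_mul_choose m k (mem_range_succ_iff.mp hj) hl]
  ring

/-- closed form for the Hahn-type norm sum. -/
theorem Tcoef_norm_closed_form (n m ℓ : ℕ) (hm : 2 * m ≤ n) (hℓ : ℓ ≤ n - 2 * m) :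
    ∑ i ∈ Finset.range (n - 2 * m + 1),
        (Tcoef n m ℓ i) ^ 2 * (((n - 2 * m).choose i : ℝ) / (n.choose (m + i))) =
      (((2 * m + ℓ).factorial : ℝ) * ((n - 2 * m).factorial : ℝ) *
          ((n + ℓ + 1).factorial : ℝ)) /
        ((2 * m + 2 * ℓ + 1) * ((m + ℓ).factorial : ℝ) ^ 2 * (ℓ.factorial : ℝ) *
          (n.factorial : ℝ) * ((n - 2 * m - ℓ).factorial : ℝ)) := by
  obtain ⟨N, rfl⟩ := Nat.exists_eq_add_of_le hm
  rw [add_tsub_cancel_left] at hℓ ⊢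
  have hcoeff : (shiftedAscPochhammer m ℓ).coeff ℓ = 1 := by
    simpa [natDegree_shiftedAscPochhammer] using
      (monic_shiftedAscPochhammer m ℓ).coeff_natDegree
  have hvanish : ∀ k < ℓ, TcoefPairing N m ℓ (shiftedAscPochhammer m k) = 0 := by
    intro k hk
    rw [TcoefPairing_shiftedAscPochhammer m k hℓ hk.le,
      Polynomial.coeff_eq_zero_of_natDegree_lt (by rwa [natDegree_shiftedAscPochhammer]),
      mul_zero, mul_zero]
  calc _ = TcoefPairing N m ℓ (TcoefPoly N m ℓ) := by
        rw [TcoefPairing_apply]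
        refine sum_congr rfl fun i hi => ?_
        rw [eval_TcoefPoly (mem_range_succ_iff.mp hi)]
        ring
    _ = _ := by
      rw [linearMap_eq_coeff_mul_of_monic _ (monic_shiftedAscPochhammer m)
        (natDegree_shiftedAscPochhammer m) hvanish (natDegree_TcoefPoly_le N m ℓ),
        coeff_TcoefPoly, TcoefPairing_shiftedAscPochhammer m ℓ hℓ le_rfl, hcoeff]
      obtain ⟨d, rfl⟩ := Nat.exists_eq_add_of_le hℓ
      rw [show 2 * m + (ℓ + d) + ℓ + 1 = (2 * m + 2 * ℓ + 1) + d by ring,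
        show 2 * m + ℓ + ℓ + 1 = 2 * m + 2 * ℓ + 1 by ring,
        show (2 * m + 2 * ℓ).choose (m + ℓ) = ((m + ℓ) + (m + ℓ)).choose (m + ℓ) by
          congr 1; ring,
        Nat.cast_add_choose, Nat.cast_add_choose, add_tsub_cancel_left,
        show m + ℓ + (m + ℓ) = 2 * m + 2 * ℓ by ring, Nat.factorial_succ (2 * m + 2 * ℓ)]
      have hf (n : ℕ) : (n.factorial : ℝ) ≠ 0 := by positivity
      push_cast
      rw [pow_add]
      field_simp [hf]
      simp [← pow_mul]
end

section
/- For all nonnegative integers n, m, ℓ₁, ℓ₂ with 2m ≤ n and ℓ₁, ℓ₂ ≤ n−2m, the following integer identity holds: Σ_{i=0}^{n−2m} Σ_{j₁=0}^{i} Σ_{j₂=0}^{i} (−1)^{j₁+j₂} C(2m+ℓ₁, m+j₁) C(2m+ℓ₂, m+j₂) C(i,j₁) C(i,j₂) C(n−2m−i, ℓ₁−j₁) C(n−2m−i, ℓ₂−j₂) C(m+i,i) C(n−m−i,m) · (ℓ₁−ℓ₂) = 0. -/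
open Finset

attribute [local instance] Classical.propDecidable

/-- The Hahn-type sum `∑ (-1)^j C(2m+l, m+j) C(a, j) C(b, l-j)` as a sum over `j + k = l`. -/
def hahnSum (m l a b : ℕ) : ℤ :=
  ∑ p ∈ antidiagonal l,
    (-1) ^ p.1 * ((2 * m + l).choose (m + p.1) : ℤ) * (a.choose p.1) * (b.choose p.2)

theorem sum_antidiagonal_eq_of_shift {M : Type*} [AddCommMonoid M] {f g : ℕ → ℕ → M}
    (hf : ∀ k, f 0 k = 0) (hg : ∀ j, g j 0 = 0) (h : ∀ j k, f (j + 1) k = g j (k + 1)) (l : ℕ) :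
    ∑ p ∈ antidiagonal l, f p.1 p.2 = ∑ p ∈ antidiagonal l, g p.1 p.2 := by
  cases l with
  | zero => simp [hf, hg]
  | succ l =>
    rw [Nat.sum_antidiagonal_succ (f := fun p => f p.1 p.2),
      Nat.sum_antidiagonal_succ' (f := fun p => g p.1 p.2)]
    simp [hf, hg, h]

theorem cast_succ_mul_choose_succ (b k : ℕ) :
    ((k : ℤ) + 1) * (b.choose (k + 1)) = (b - k) * b.choose k := by
  rcases le_or_gt k b with h | h
  · have := Nat.choose_succ_right_eq b k
    zify [h] at this
    linarith
  · simp [Nat.choose_eq_zero_of_lt h, Nat.choose_eq_zero_of_lt (h.trans (Nat.lt_succ_self k))]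

theorem cast_mul_choose_pred (b k : ℕ) :
    (b : ℤ) * ((b - 1).choose k) = (b - k) * b.choose k := by
  cases b with
  | zero => cases k <;> simp
  | succ b =>
    rw [← cast_succ_mul_choose_succ, Nat.add_sub_cancel]
    have := Nat.add_one_mul_choose_eq b k
    zify at this
    push_cast
    linarith

/-- The binomial coefficient `C(a, j - 1)`, equal to `0` at `j = 0`. -/
def choosePred (a : ℕ) : ℕ → ℤ
  | 0 => 0
  | j + 1 => a.choose j

theorem choose_succ_eq_add_choosePred (a j : ℕ) :
    ((a + 1).choose j : ℤ) = a.choose j + choosePred a j := by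
  cases j with
  | zero => simp [choosePred]
  | succ j => simp [choosePred, Nat.choose_succ_succ, add_comm]

theorem cast_mul_choose_eq_choosePred (a j : ℕ) :
    (j : ℤ) * a.choose j = (a - j + 1) * choosePred a j := by
  cases j with
  | zero => simp [choosePred]
  | succ j =>
    simp only [choosePred]
    push_cast
    rw [cast_succ_mul_choose_succ]
    ring

/-- The Hahn difference operator applied to `C(a, j) C(b, k)`. -/
theorem difference_choose_mul_choose (m a b j k : ℕ) :
    (b : ℤ) * (a + m + 1) * ((a + 1).choose j * (b - 1).choose k - a.choose j * b.choose k) +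
      a * (b + m + 1) * ((a - 1).choose j * (b + 1).choose k - a.choose j * b.choose k) =
    -((m + 1) * (j + k) + 2 * j * k) * (a.choose j * b.choose k) +
      (m + j) * (choosePred a j * ((k + 1) * b.choose (k + 1))) +
      (m + k) * (((j + 1) * a.choose (j + 1)) * choosePred b k) := by
  have ha := cast_mul_choose_pred a j
  have hb := cast_mul_choose_pred b k
  have hua := cast_mul_choose_eq_choosePred a j
  have hub := cast_mul_choose_eq_choosePred b k
  rw [cast_succ_mul_choose_succ, cast_succ_mul_choose_succ, choose_succ_eq_add_choosePred,
    choose_succ_eq_add_choosePred]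
  generalize ((a - 1).choose j : ℤ) = ua at *
  generalize ((b - 1).choose k : ℤ) = vb at *
  generalize (a.choose j : ℤ) = u at *
  generalize (b.choose k : ℤ) = v at *
  generalize choosePred a j = u' at *
  generalize choosePred b k = v' at *
  linear_combination (a + m + 1 : ℤ) * (u + u') * hb + (b + m + 1 : ℤ) * (v + v') * ha -
    (a - j : ℤ) * u * hub - (b - k : ℤ) * v * hua

theorem hahnSum_difference_eq (m l a b : ℕ) :
    (b : ℤ) * (a + m + 1) * (hahnSum m l (a + 1) (b - 1) - hahnSum m l a b) +
      a * (b + m + 1) * (hahnSum m l (a - 1) (b + 1) - hahnSum m l a b) =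
    -(l * (l + 2 * m + 1)) * hahnSum m l a b := by
  let c : ℕ → ℤ := fun j => (-1) ^ j * ((2 * m + l).choose (m + j) : ℤ)
  have hup : ∑ p ∈ antidiagonal l,
      c p.1 * ((m + p.1) * (choosePred a p.1 * ((p.2 + 1) * b.choose (p.2 + 1)))) =
      ∑ p ∈ antidiagonal l,
        c (p.1 + 1) * ((m + p.1 + 1) * (a.choose p.1 * (p.2 * b.choose p.2))) :=
    sum_antidiagonal_eq_of_shift
      (f := fun j k => c j * ((m + j) * (choosePred a j * ((k + 1) * b.choose (k + 1)))))
      (g := fun j k => c (j + 1) * ((m + j + 1) * (a.choose j * (k * b.choose k))))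
      (by simp [choosePred]) (by simp) (by intros; simp only [choosePred]; push_cast; ring) l
  have hdown : ∑ p ∈ antidiagonal l,
      c (p.1 - 1) * ((m + p.2 + 1) * ((p.1 * a.choose p.1) * b.choose p.2)) =
      ∑ p ∈ antidiagonal l,
        c p.1 * ((m + p.2) * (((p.1 + 1) * a.choose (p.1 + 1)) * choosePred b p.2)) :=
    sum_antidiagonal_eq_of_shift
      (f := fun j k => c (j - 1) * ((m + k + 1) * ((j * a.choose j) * b.choose k)))
      (g := fun j k => c j * ((m + k) * (((j + 1) * a.choose (j + 1)) * choosePred b k)))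
      (by simp) (by simp [choosePred]) (by intros; simp only [choosePred, Nat.add_sub_cancel]; push_cast; ring) l
  have hc : ∀ j k, j + k = l → c (j + 1) * (m + j + 1) = -(m + k) * c j := by
    intro j k hjk
    have := cast_succ_mul_choose_succ (2 * m + l) (m + j)
    simp only [c, ← add_assoc, pow_succ]
    subst hjk
    push_cast at this ⊢
    linear_combination -(-1) ^ j * this
  calc _ = ∑ p ∈ antidiagonal l, (c p.1 *
          (-((m + 1) * (p.1 + p.2) + 2 * p.1 * p.2) * (a.choose p.1 * b.choose p.2))) +
        ∑ p ∈ antidiagonal l,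
          c p.1 * ((m + p.1) * (choosePred a p.1 * ((p.2 + 1) * b.choose (p.2 + 1)))) +
        ∑ p ∈ antidiagonal l,
          c p.1 * ((m + p.2) * (((p.1 + 1) * a.choose (p.1 + 1)) * choosePred b p.2)) := by
        simp only [hahnSum, ← sum_sub_distrib, mul_sum, ← sum_add_distrib]
        refine sum_congr rfl fun p _ => ?_
        linear_combination c p.1 * difference_choose_mul_choose m a b p.1 p.2
    _ = _ := by
        rw [hup, ← hdown, hahnSum, mul_sum, ← sum_add_distrib, ← sum_add_distrib]
        refine sum_congr rfl ?_
        rintro ⟨j, k⟩ hp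
        have hjk : j + k = l := by simpa using hp
        have hl : (l : ℤ) = j + k := by rw [← hjk]; push_cast; rfl
        have hlow : (j : ℤ) * (c (j - 1) * (m + k + 1)) = -j * ((m + j) * c j) := by
          cases j with
          | zero => simp
          | succ j =>
            have := hc j (k + 1) (by omega)
            simp only [Nat.add_sub_cancel]
            push_cast at this ⊢
            linear_combination (j + 1 : ℤ) * this
        have hhigh := hc j k hjk
        change _ = -((l : ℤ) * (l + 2 * m + 1)) * (c j * a.choose j * b.choose k)
        rw [hl]
        linear_combination (a.choose j * b.choose k : ℤ) * hlow +
          (k * a.choose j * b.choose k : ℤ) * hhigh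

/-- The weight `C(m+a, a) C(m+b, m)` of the orthogonality relation. -/
def hahnWeight (m a b : ℕ) : ℤ := (m + a).choose a * (m + b).choose m

theorem hahnWeight_shift (m a b : ℕ) :
    hahnWeight m (a + 1) b * ((a + 1) * (b + m + 1)) =
      hahnWeight m a (b + 1) * ((b + 1) * (a + m + 1)) := by
  have ha := cast_succ_mul_choose_succ (m + (a + 1)) a
  have hb := cast_mul_choose_pred (m + (b + 1)) m
  have ha' := Nat.add_one_mul_choose_eq (m + a) a
  zify at ha'
  simp only [hahnWeight, ← add_assoc, Nat.add_sub_cancel] at *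
  push_cast at *
  linear_combination -((b + m + 1 : ℤ) * (m + b).choose m) * ha' +
    ((m + a + 1 : ℤ) * (m + a).choose a) * hb

theorem sum_hahnWeight_mul_hahnSum_eq_zero (m N l₁ l₂ : ℕ) :
    (∑ p ∈ antidiagonal N,
      hahnWeight m p.1 p.2 * hahnSum m l₁ p.1 p.2 * hahnSum m l₂ p.1 p.2) *
      ((l₁ : ℤ) - l₂) = 0 := by
  have hshift : ∑ p ∈ antidiagonal N, hahnWeight m p.1 p.2 * (p.1 * (p.2 + m + 1)) *
        (hahnSum m l₁ (p.1 - 1) (p.2 + 1) * hahnSum m l₂ p.1 p.2 -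
          hahnSum m l₂ (p.1 - 1) (p.2 + 1) * hahnSum m l₁ p.1 p.2) =
      ∑ p ∈ antidiagonal N, -(hahnWeight m p.1 p.2 * (p.2 * (p.1 + m + 1)) *
        (hahnSum m l₁ (p.1 + 1) (p.2 - 1) * hahnSum m l₂ p.1 p.2 -
          hahnSum m l₂ (p.1 + 1) (p.2 - 1) * hahnSum m l₁ p.1 p.2)) := by
    refine sum_antidiagonal_eq_of_shift
      (f := fun a b => hahnWeight m a b * (a * (b + m + 1)) *
        (hahnSum m l₁ (a - 1) (b + 1) * hahnSum m l₂ a b -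
          hahnSum m l₂ (a - 1) (b + 1) * hahnSum m l₁ a b))
      (g := fun a b => -(hahnWeight m a b * (b * (a + m + 1)) *
        (hahnSum m l₁ (a + 1) (b - 1) * hahnSum m l₂ a b -
          hahnSum m l₂ (a + 1) (b - 1) * hahnSum m l₁ a b))) (by simp) (by simp) ?_ N
    intro a b
    simp only [Nat.add_sub_cancel]
    push_cast
    rw [hahnWeight_shift]
    ring
  have hmul : (∑ p ∈ antidiagonal N,
      hahnWeight m p.1 p.2 * hahnSum m l₁ p.1 p.2 * hahnSum m l₂ p.1 p.2) *
      ((l₁ : ℤ) - l₂) * (l₁ + l₂ + 2 * m + 1) = 0 := by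
    rw [← sub_eq_zero, ← sum_sub_distrib] at hshift
    rw [← neg_eq_zero, ← hshift, sum_mul, sum_mul, ← sum_neg_distrib]
    refine sum_congr rfl fun p _ => ?_
    linear_combination
      -(hahnWeight m p.1 p.2 * hahnSum m l₂ p.1 p.2) * hahnSum_difference_eq m l₁ p.1 p.2 +
      (hahnWeight m p.1 p.2 * hahnSum m l₁ p.1 p.2) * hahnSum_difference_eq m l₂ p.1 p.2
  exact (mul_eq_zero.mp hmul).resolve_right (by positivity)

theorem hahnSum_eq_sum_range (m l a b : ℕ) :
    hahnSum m l a b = ∑ j ∈ range (a + 1), if j ≤ l then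
      (-1) ^ j * ((2 * m + l).choose (m + j) : ℤ) * (a.choose j) * (b.choose (l - j)) else 0 := by
  rw [hahnSum, Nat.sum_antidiagonal_eq_sum_range_succ_mk, ← sum_filter]
  symm
  apply sum_subset
  · intro j hj
    simp only [mem_filter, mem_range] at hj ⊢
    omega
  · intro j hj hj'
    simp only [mem_filter, mem_range] at hj hj'
    rw [Nat.choose_eq_zero_of_lt (show a < j by omega)]
    simp

/-- the integer triple-sum identity (the WZ-certified orthogonality identity).
The convention C(a,b) = 0 for b < 0 is implemented by the indicator j₁ ≤ ℓ₁ ∧ j₂ ≤ ℓ₂. -/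
theorem triple_sum_identity (n m l1 l2 : ℕ) (hm : 2 * m ≤ n)
    (h1 : l1 ≤ n - 2 * m) (h2 : l2 ≤ n - 2 * m) :
    (∑ i ∈ Finset.range (n - 2 * m + 1), ∑ j1 ∈ Finset.range (i + 1),
      ∑ j2 ∈ Finset.range (i + 1),
        if j1 ≤ l1 ∧ j2 ≤ l2 then
          (-1 : ℤ) ^ (j1 + j2) * ((2 * m + l1).choose (m + j1)) *
            ((2 * m + l2).choose (m + j2)) * (i.choose j1) * (i.choose j2) *
            ((n - 2 * m - i).choose (l1 - j1)) * ((n - 2 * m - i).choose (l2 - j2)) *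
            ((m + i).choose i) * ((n - m - i).choose m) * ((l1 : ℤ) - (l2 : ℤ))
        else 0) = 0 := by
  refine Eq.trans ?_ (sum_hahnWeight_mul_hahnSum_eq_zero m (n - 2 * m) l1 l2)
  rw [Nat.sum_antidiagonal_eq_sum_range_succ_mk, sum_mul]
  refine sum_congr rfl fun i hi => ?_
  have hi' : n - m - i = m + (n - 2 * m - i) := by
    have := mem_range.mp hi
    omega
  rw [hahnSum_eq_sum_range, hahnSum_eq_sum_range, mul_assoc (hahnWeight _ _ _), sum_mul_sum,
    mul_sum, sum_mul]
  refine sum_congr rfl fun j1 _ => ?_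
  rw [mul_sum, sum_mul]
  refine sum_congr rfl fun j2 _ => ?_
  rw [hi', hahnWeight]
  by_cases hj1 : j1 ≤ l1 <;> by_cases hj2 : j2 ≤ l2 <;> simp only [hj1, hj2, and_self,
    and_true, and_false, if_true, if_false, mul_zero, zero_mul]
  ring
end

section
/- View K_n as a linear endomorphism of the 2^n-dimensional real vector space of functions C_2^n → ℝ via (K_n f)(x) = Σ_y K_n(x,y) f(y). Then: the eigenspace of K_n for eigenvalue 1 has dimension 1; for each integer 1 ≤ k ≤ ⌊n/2⌋, the eigenspace for eigenvalue β_k = C(2k,k)²/16^k has dimension C(n,2k); and the kernel of K_n has dimension 2^{n−1}. -/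
open Finset

attribute [local instance] Classical.propDecidable

section Triangular

variable {ι 𝕜 V : Type*} [PartialOrder ι] [WellFoundedLT ι] [Field 𝕜] [AddCommGroup V]
  [Module 𝕜 V]

lemma basis_mem_map_sub_smul (K : Module.End 𝕜 V) (b : ι → V) (d : ι → 𝕜)
    (hK : ∀ i, K (b i) - d i • b i ∈ Submodule.span 𝕜 (b '' Set.Iio i)) (μ : 𝕜) (i : ι)
    (hi : ∀ j ≤ i, d j ≠ μ) :
    b i ∈ (Submodule.span 𝕜 (b '' Set.Iic i)).map (K - algebraMap 𝕜 _ μ) := by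
  induction i using WellFoundedLT.induction with
  | ind i ih =>
  have hlower : Submodule.span 𝕜 (b '' Set.Iio i) ≤
      (Submodule.span 𝕜 (b '' Set.Iic i)).map (K - algebraMap 𝕜 _ μ) := by
    rw [Submodule.span_le]
    rintro _ ⟨j, hj, rfl⟩
    exact Submodule.map_mono (Submodule.span_mono (Set.image_mono (Set.Iic_subset_Iic.2 hj.le)))
      (ih j hj fun l hl => hi l (hl.trans hj.le))
  have hself : (K - algebraMap 𝕜 (Module.End 𝕜 V) μ) (b i) ∈
      (Submodule.span 𝕜 (b '' Set.Iic i)).map (K - algebraMap 𝕜 _ μ) :=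
    Submodule.mem_map_of_mem (Submodule.subset_span ⟨i, le_rfl, rfl⟩)
  have hmem := Submodule.smul_mem _ (d i - μ)⁻¹ (Submodule.sub_mem _ hself (hlower (hK i)))
  have hne : d i - μ ≠ 0 := sub_ne_zero.2 (hi i le_rfl)
  convert hmem using 1
  rw [eq_inv_smul_iff₀ hne]
  simp [Module.algebraMap_end_apply, sub_smul]

/-- If `K` is triangular in the basis `b` with diagonal `d`, and `s` is a set of indices whose
diagonal entry is `μ` while no strictly smaller index has diagonal entry `μ`, then the
`μ`-eigenspace of `K` has dimension at least `#s`. -/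
lemma card_le_finrank_eigenspace_of_triangular [FiniteDimensional 𝕜 V] (K : Module.End 𝕜 V)
    (b : Module.Basis ι 𝕜 V) (d : ι → 𝕜)
    (hK : ∀ i, K (b i) - d i • b i ∈ Submodule.span 𝕜 (b '' Set.Iio i)) (μ : 𝕜) (s : Finset ι)
    (hs : ∀ i ∈ s, d i = μ ∧ ∀ j < i, d j ≠ μ) :
    #s ≤ Module.finrank 𝕜 (K.eigenspace μ) := by
  have hex : ∀ i : s, ∃ g ∈ Submodule.span 𝕜 (b '' Set.Iio i.1), b i - g ∈ K.eigenspace μ := by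
    rintro ⟨i, hi⟩
    have hlower : Submodule.span 𝕜 (b '' Set.Iio i) ≤
        (Submodule.span 𝕜 (b '' Set.Iio i)).map (K - algebraMap 𝕜 _ μ) := by
      rw [Submodule.span_le]
      rintro _ ⟨j, hj, rfl⟩
      exact Submodule.map_mono
        (Submodule.span_mono (Set.image_mono fun l hl => lt_of_le_of_lt hl hj))
        (basis_mem_map_sub_smul K b d hK μ j fun l hl => (hs i hi).2 l (hl.trans_lt hj))
    obtain ⟨g, hg, hgi⟩ := hlower (hK i)
    refine ⟨g, hg, ?_⟩
    rw [(hs i hi).1] at hgi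
    rw [Module.End.mem_eigenspace_iff, ← sub_eq_zero]
    simp only [LinearMap.sub_apply, Module.algebraMap_end_apply] at hgi
    rw [map_sub, smul_sub, sub_sub_sub_comm, hgi, sub_self]
  choose g hg hv using hex
  have hcoord : ∀ i j : s, b.coord i (g j) = 0 := by
    intro i j
    have : Submodule.span 𝕜 (b '' Set.Iio j.1) ≤ LinearMap.ker (b.coord i) := by
      rw [Submodule.span_le]
      rintro _ ⟨l, hl, rfl⟩
      have hli : l ≠ i := by
        rintro rfl
        exact (hs j j.2).2 _ hl (hs i i.2).1
      simp [hli]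
    exact this (hg j)
  have hli : LinearIndependent 𝕜 fun i : s => b i - g i := by
    refine LinearIndependent.of_pairwise_dual_eq_zero_one _ (fun i : s => b.coord i) ?_ ?_
    · intro i j hij
      have : (j : ι) ≠ i := fun h => hij (Subtype.ext h.symm)
      simp only [map_sub, hcoord, sub_zero]
      simp [this]
    · intro i
      simp only [map_sub, hcoord, sub_zero]
      simp
  have hli' : LinearIndependent 𝕜 fun i : s => (⟨b i - g i, hv i⟩ : K.eigenspace μ) :=
    LinearIndependent.of_comp (K.eigenspace μ).subtype hli
  simpa using hli'.fintype_card_le_finrank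

end Triangular

section CentralBinomial

open Polynomial

lemma coeff_sub_mul_sub_pow (R : Type*) [CommRing R] (w : R) (m : ℕ) :
    ((C w * (1 + X) ^ 2 - X * C ((1 + w) ^ 2)) ^ m : R[X]).coeff m =
      ∑ b ∈ range (m + 1), (-1) ^ (m - b) * (m.choose b : R) * w ^ b * (b.centralBinom : R) *
        (1 + w) ^ (2 * (m - b)) := by
  rw [sub_eq_add_neg, add_pow, finsetSum_coeff]
  refine Finset.sum_congr rfl fun b hb => ?_
  have hb : b ≤ m := Nat.lt_succ_iff.1 (mem_range.1 hb)
  have : (C w * (1 + X) ^ 2 : R[X]) ^ b * (-(X * C ((1 + w) ^ 2))) ^ (m - b) * (m.choose b : R[X])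
      = C ((-1) ^ (m - b) * (m.choose b : R) * w ^ b * (1 + w) ^ (2 * (m - b))) *
        (X ^ (m - b) * (1 + X) ^ (2 * b)) := by
    rw [neg_pow, mul_pow, mul_pow X, ← pow_mul]
    simp only [map_mul, map_pow, map_neg, map_one, map_natCast]
    ring
  rw [this, coeff_C_mul, coeff_X_pow_mul', if_pos (Nat.sub_le _ _), Nat.sub_sub_self hb,
    coeff_one_add_X_pow, Nat.centralBinom]
  ring

lemma coeff_X_sub_pow_mul_pow (R : Type*) [CommRing R] (w : R) (m : ℕ) :
    (((X - C w) * (X * C w - 1)) ^ m : R[X]).coeff m =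
      (-1) ^ m * ∑ j ∈ range (m + 1), (m.choose j : R) ^ 2 * w ^ (2 * j) := by
  have hX : ((X * C w - 1) ^ m : R[X]) =
      ∑ j ∈ range (m + 1), C ((-1) ^ (m - j) * (m.choose j : R) * w ^ j) * X ^ j := by
    rw [sub_eq_add_neg, add_pow]
    refine Finset.sum_congr rfl fun j _ => ?_
    simp only [map_mul, map_pow, map_neg, map_one, map_natCast]
    ring
  rw [mul_pow, hX, Finset.mul_sum, finsetSum_coeff, Finset.mul_sum]
  refine Finset.sum_congr rfl fun j hj => ?_
  have hj : j ≤ m := Nat.lt_succ_iff.1 (mem_range.1 hj)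
  rw [mul_left_comm, coeff_C_mul, coeff_mul_X_pow', if_pos hj, sub_eq_add_neg X,
    ← C_neg, coeff_X_add_C_pow, Nat.sub_sub_self hj, Nat.choose_symm hj, neg_pow]
  have : (-1 : R) ^ m = (-1) ^ (m - j) * (-1) ^ j := by rw [← pow_add, Nat.sub_add_cancel hj]
  rw [this]
  ring

lemma sum_neg_one_pow_choose_mul_centralBinom (m : ℕ) :
    ∑ b ∈ range (m + 1), (-1 : ℤ) ^ (m - b) * m.choose b * (b.centralBinom *
      (m - b).centralBinom) = if Even m then (m.choose (m / 2) : ℤ) ^ 2 else 0 := by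
  have h := congrArg (fun p => Polynomial.coeff p m)
    ((coeff_sub_mul_sub_pow ℤ[X] X m).symm.trans (Eq.trans (by congr 2; simp; ring)
      (coeff_X_sub_pow_mul_pow ℤ[X] X m)))
  simp only [finsetSum_coeff] at h
  have hl : ∀ b ∈ range (m + 1), (((-1) ^ (m - b) * (m.choose b : ℤ[X]) * X ^ b *
      (b.centralBinom : ℤ[X]) * (1 + X) ^ (2 * (m - b)) : ℤ[X])).coeff m =
      (-1 : ℤ) ^ (m - b) * m.choose b * (b.centralBinom * (m - b).centralBinom) := by
    intro b hb
    have hb : b ≤ m := Nat.lt_succ_iff.1 (mem_range.1 hb)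
    have : ((-1) ^ (m - b) * (m.choose b : ℤ[X]) * X ^ b *
      (b.centralBinom : ℤ[X]) * (1 + X) ^ (2 * (m - b)) : ℤ[X]) =
      C ((-1 : ℤ) ^ (m - b) * m.choose b * b.centralBinom) *
        (X ^ b * (1 + X) ^ (2 * (m - b))) := by
      simp only [map_mul, map_pow, map_neg, map_one, map_natCast]
      ring
    rw [this, coeff_C_mul, coeff_X_pow_mul', if_pos hb, coeff_one_add_X_pow, Nat.centralBinom,
      Nat.centralBinom]
    ring
  rw [Finset.sum_congr rfl hl] at h
  rw [h]
  have hr : ((-1) ^ m * ∑ j ∈ range (m + 1), (m.choose j : ℤ[X]) ^ 2 * X ^ (2 * j) : ℤ[X]) =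
      ∑ j ∈ range (m + 1), C ((-1 : ℤ) ^ m * (m.choose j : ℤ) ^ 2) * X ^ (2 * j) := by
    rw [Finset.mul_sum]
    refine Finset.sum_congr rfl fun j _ => ?_
    simp only [map_mul, map_pow, map_neg, map_one, map_natCast]
    ring
  rw [hr, finsetSum_coeff]
  simp only [coeff_C_mul_X_pow]
  split_ifs with hm
  · rw [Finset.sum_eq_single (m / 2)]
    · rw [if_pos (Nat.two_mul_div_two_of_even hm).symm, hm.neg_one_pow, one_mul]
    · intro j _ hj
      rw [if_neg]
      omega
    · intro hj
      exact absurd (mem_range.2 (by omega)) hj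
  · refine Finset.sum_eq_zero fun j _ => if_neg ?_
    rintro rfl
    exact hm (even_two_mul j)

end CentralBinomial

/-- The probability that `i + j` conditionally independent coin tosses, whose success probability
is arcsine distributed, yield a prescribed pattern with `i` ones and `j` zeros. -/
noncomputable def arcsineWeight (i j : ℕ) : ℝ :=
  (i.centralBinom * j.centralBinom : ℝ) / (4 ^ (i + j) * (i + j).choose i)

lemma arcsineWeight_comm (i j : ℕ) : arcsineWeight i j = arcsineWeight j i := by
  rw [arcsineWeight, arcsineWeight, add_comm j i, Nat.choose_symm_add, mul_comm (j.centralBinom : ℝ)]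

lemma arcsineWeight_zero_right (i : ℕ) : arcsineWeight i 0 = i.centralBinom / 4 ^ i := by
  simp [arcsineWeight]

lemma arcsineWeight_succ_add (i j : ℕ) :
    arcsineWeight (i + 1) j + arcsineWeight i (j + 1) = arcsineWeight i j := by
  have hi : ((i : ℝ) + 1) * (i + 1).centralBinom = 2 * (2 * i + 1) * i.centralBinom := by
    exact_mod_cast Nat.succ_mul_centralBinom_succ i
  have hj : ((j : ℝ) + 1) * (j + 1).centralBinom = 2 * (2 * j + 1) * j.centralBinom := by
    exact_mod_cast Nat.succ_mul_centralBinom_succ j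
  have hci : ((i : ℝ) + j + 1) * (i + j).choose i = (i + j + 1).choose (i + 1) * (i + 1) := by
    exact_mod_cast Nat.add_one_mul_choose_eq (i + j) i
  have hcj : ((i : ℝ) + j + 1) * (i + j).choose i = (i + j + 1).choose i * (j + 1) := by
    have h := Nat.choose_mul_succ_eq (i + j) i
    rw [show i + j + 1 - i = j + 1 by omega] at h
    rw [mul_comm]
    exact_mod_cast h
  have hpi : ((i : ℝ) + 1) ≠ 0 := by positivity
  have hpj : ((j : ℝ) + 1) ≠ 0 := by positivity
  have hpij : ((i : ℝ) + j + 1) ≠ 0 := by positivity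
  have hc : ((i + j).choose i : ℝ) ≠ 0 := by
    exact_mod_cast (Nat.choose_pos (Nat.le_add_right i j)).ne'
  rw [mul_comm, ← eq_div_iff hpi] at hi
  rw [mul_comm, ← eq_div_iff hpj] at hj
  rw [← div_eq_iff hpi] at hci
  rw [← div_eq_iff hpj] at hcj
  rw [arcsineWeight, arcsineWeight, arcsineWeight, show i + 1 + j = i + j + 1 by ring,
    ← add_assoc, hi, hj, ← hci, ← hcj]
  field_simp
  ring

lemma sum_powerset_arcsineWeight {α : Type*} [DecidableEq α] (x D : Finset α) (i j k l : ℕ) :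
    ∑ R ∈ D.powerset, arcsineWeight (i + #(x ∩ R)) (j + #(x ∩ (D \ R))) *
        arcsineWeight (k + #(R \ x)) (l + #((D \ R) \ x)) =
      arcsineWeight i j * arcsineWeight k l := by
  induction D using Finset.induction_on generalizing i j k l with
  | empty => simp
  | insert a D ha ih =>
    rw [Finset.sum_powerset_insert ha, add_comm]
    have haR : ∀ R ∈ D.powerset, a ∉ R := fun R hR h => ha (mem_powerset.1 hR h)
    have hins : ∀ R ∈ D.powerset, insert a D \ insert a R = D \ R := by
      intro R _
      grind
    by_cases hax : a ∈ x
    · rw [← arcsineWeight_succ_add i j, add_mul, ← ih, ← ih]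
      congr 1 <;> refine Finset.sum_congr rfl fun R hR => ?_
      · rw [hins R hR, Finset.inter_insert_of_mem hax, Finset.insert_sdiff_of_mem _ hax,
          card_insert_of_notMem (by simp [haR R hR])]
        ring_nf
      · rw [Finset.insert_sdiff_of_notMem _ (haR R hR), Finset.inter_insert_of_mem hax,
          Finset.insert_sdiff_of_mem _ hax, card_insert_of_notMem (by simp [ha])]
        ring_nf
    · rw [← arcsineWeight_succ_add k l, mul_add, ← ih, ← ih]
      congr 1 <;> refine Finset.sum_congr rfl fun R hR => ?_
      · rw [hins R hR, Finset.inter_insert_of_notMem hax, Finset.insert_sdiff_of_notMem _ hax,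
          card_insert_of_notMem (by simp [haR R hR])]
        ring_nf
      · rw [Finset.insert_sdiff_of_notMem _ (haR R hR), Finset.inter_insert_of_notMem hax,
          Finset.insert_sdiff_of_notMem _ hax, card_insert_of_notMem (by simp [ha])]
        ring_nf

lemma Kmat_eq_arcsineWeight {n : ℕ} {x y : Finset ℕ} (hx : x ⊆ Icc 1 n) (hy : y ⊆ Icc 1 n) :
    Kmat n x y = arcsineWeight #(x ∩ y) #(x ∩ (Icc 1 n \ y)) *
      arcsineWeight #(y \ x) #((Icc 1 n \ y) \ x) := by
  have h₁ : x ∩ (Icc 1 n \ y) = x \ y := by grind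
  have h₂ : #((Icc 1 n \ y) \ x) = n - #(x ∪ y) := by
    have : (Icc 1 n \ y) \ x = Icc 1 n \ (x ∪ y) := by grind
    rw [this, card_sdiff_of_subset (union_subset hx hy), Nat.card_Icc, Nat.add_sub_cancel]
  have hn : #(x ∩ y) + #(x \ y) + (#(y \ x) + (n - #(x ∪ y))) = n := by
    have h₃ := card_le_card (union_subset hx hy)
    have h₄ := card_inter_add_card_sdiff x y
    have h₅ := card_union_add_card_inter x y
    have h₆ := card_inter_add_card_sdiff y x
    rw [inter_comm y x] at h₆
    rw [Nat.card_Icc] at h₃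
    omega
  have h4 : (4 : ℝ) ^ n = 4 ^ #(x ∩ y) * 4 ^ #(x \ y) * (4 ^ #(y \ x) * 4 ^ (n - #(x ∪ y))) := by
    rw [← pow_add, ← pow_add, ← pow_add, hn]
  rw [h₁, h₂, arcsineWeight_comm (#(x ∩ y)), arcsineWeight_comm (#(y \ x)), Kmat, h4, arcsineWeight,
    arcsineWeight, div_mul_div_comm]
  simp only [Nat.centralBinom, pow_add]
  congr 1 <;> ring

lemma sum_Kmat_filter_subset {n : ℕ} {x S : Finset ℕ} (hx : x ⊆ Icc 1 n) (hS : S ⊆ Icc 1 n) :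
    ∑ y ∈ (Icc 1 n).powerset with S ⊆ y, Kmat n x y =
      (#(x ∩ S)).centralBinom * (#(S \ x)).centralBinom / 4 ^ #S := by
  have hfilter : {y ∈ (Icc 1 n).powerset | S ⊆ y} =
      ((Icc 1 n \ S).powerset).image (S ∪ ·) := by
    rw [← Finset.Icc_eq_image_powerset hS]
    ext y
    simp [Finset.mem_Icc, and_comm]
  have hinj : Set.InjOn (S ∪ ·) ((Icc 1 n \ S).powerset : Set (Finset ℕ)) := by
    intro R hR R' hR' h
    have hR := mem_powerset.1 hR
    have hR' := mem_powerset.1 hR'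
    have h : S ∪ R = S ∪ R' := h
    rw [← union_sdiff_cancel_left (disjoint_of_subset_right hR disjoint_sdiff), h,
      union_sdiff_cancel_left (disjoint_of_subset_right hR' disjoint_sdiff)]
  rw [hfilter, Finset.sum_image hinj]
  trans arcsineWeight #(x ∩ S) 0 * arcsineWeight #(S \ x) 0
  · rw [← sum_powerset_arcsineWeight x (Icc 1 n \ S)]
    refine Finset.sum_congr rfl fun R hR => ?_
    have hR := mem_powerset.1 hR
    have hSR : Disjoint S R := disjoint_of_subset_right hR disjoint_sdiff
    have hsd : Icc 1 n \ (S ∪ R) = (Icc 1 n \ S) \ R := by grind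
    rw [Kmat_eq_arcsineWeight hx (union_subset hS (hR.trans sdiff_subset)),
      inter_union_distrib_left, union_sdiff_distrib, hsd,
      card_union_of_disjoint (hSR.mono inter_subset_right inter_subset_right),
      card_union_of_disjoint (hSR.mono sdiff_subset sdiff_subset), zero_add, zero_add]
  · rw [arcsineWeight_zero_right, arcsineWeight_zero_right, div_mul_div_comm, ← pow_add,
      inter_comm, card_inter_add_card_sdiff]

/-- The indicator function of the supersets of `S`. -/
noncomputable def upIndicator (n : ℕ) (S : (Icc 1 n).powerset) : (Icc 1 n).powerset → ℝ :=
  fun y => if S.1 ⊆ y.1 then 1 else 0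

lemma linearIndependent_upIndicator (n : ℕ) : LinearIndependent ℝ (upIndicator n) := by
  rw [Fintype.linearIndependent_iff]
  intro g hg S
  induction S using WellFoundedLT.induction with
  | ind S ih =>
  have h := congrFun hg S
  rw [Finset.sum_apply, Finset.sum_eq_single S] at h
  · simpa [upIndicator] using h
  · intro T _ hTS
    by_cases hT : T.1 ⊆ S.1
    · simp [ih T (lt_of_le_of_ne hT hTS)]
    · simp [upIndicator, hT]
  · simp

lemma KEndo_upIndicator_apply (n : ℕ) (S x : (Icc 1 n).powerset) :
    KEndo n (upIndicator n S) x =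
      (#(x.1 ∩ S.1)).centralBinom * (#S.1 - #(x.1 ∩ S.1)).centralBinom / 4 ^ #S.1 := by
  have h : #S.1 - #(x.1 ∩ S.1) = #(S.1 \ x.1) := by rw [card_sdiff]
  rw [h, ← sum_Kmat_filter_subset (mem_powerset.1 x.2) (mem_powerset.1 S.2), Finset.sum_filter,
    ← Finset.sum_coe_sort]
  simp [KEndo, upIndicator]

/-- The diagonal entry of `KEndo` at a set of size `m`, in the basis `upIndicator`. -/
noncomputable def diagEntry (m : ℕ) : ℝ := if Even m then betaEV (m / 2) else 0

lemma fwdDiff_iter_centralBinom (m : ℕ) :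
    (fwdDiff 1)^[m] (fun b : ℕ => (b.centralBinom * (m - b).centralBinom / 4 ^ m : ℝ)) 0 =
      diagEntry m := by
  have h := congrArg (Int.cast : ℤ → ℝ) (sum_neg_one_pow_choose_mul_centralBinom m)
  rw [fwdDiff_iter_eq_sum_shift, diagEntry]
  push_cast at h
  simp only [zero_add, smul_eq_mul, mul_one, zsmul_eq_mul, mul_div_assoc']
  push_cast
  rw [← Finset.sum_div, h]
  split_ifs with hm
  · rw [betaEV, Nat.two_mul_div_two_of_even hm, show (16 : ℝ) = 4 ^ 2 by norm_num, ← pow_mul,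
      Nat.two_mul_div_two_of_even hm]
  · simp

lemma KEndo_upIndicator_sub_mem (n : ℕ) (S : (Icc 1 n).powerset) :
    KEndo n (upIndicator n S) - diagEntry #S.1 • upIndicator n S ∈
      Submodule.span ℝ (upIndicator n '' Set.Iio S) := by
  set h : ℕ → ℝ := fun b => b.centralBinom * (#S.1 - b).centralBinom / 4 ^ #S.1 with hdef
  have hsum : KEndo n (upIndicator n S) =
      ∑ T with T ≤ S, (fwdDiff 1)^[#T.1] h 0 • upIndicator n T := by
    ext x
    have hn := shift_eq_sum_fwdDiff_iter 1 h #(x.1 ∩ S.1) 0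
    rw [← sum_powerset_apply_card (fun k => (fwdDiff 1)^[k] h 0)] at hn
    simp only [smul_eq_mul, mul_one, zero_add] at hn
    rw [KEndo_upIndicator_apply, Finset.sum_apply]
    refine hn.trans ?_
    have hpow : (x.1 ∩ S.1).powerset = {T ∈ {T ∈ (Icc 1 n).powerset | T ⊆ S.1} | T ⊆ x.1} := by
      have := mem_powerset.1 S.2
      ext T
      simp only [mem_powerset, mem_filter, subset_inter_iff]
      exact ⟨fun hT => ⟨⟨hT.2.trans this, hT.2⟩, hT.1⟩, fun hT => ⟨hT.2, hT.1.2⟩⟩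
    rw [hpow, Finset.sum_filter, Finset.sum_filter, Finset.sum_filter, ← Finset.sum_coe_sort]
    refine Finset.sum_congr rfl fun T _ => ?_
    simp [upIndicator, ← Subtype.coe_le_coe]
  rw [hsum, ← Finset.add_sum_erase _ _ (show S ∈ ({T | T ≤ S} : Finset _) by simp),
    fwdDiff_iter_centralBinom, add_sub_cancel_left]
  refine Submodule.sum_mem _ fun T hT => Submodule.smul_mem _ _ (Submodule.subset_span ?_)
  have hT := mem_erase.1 hT
  exact ⟨T, lt_of_le_of_ne (mem_filter.1 hT.2).2 hT.1, rfl⟩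

lemma betaEV_zero : betaEV 0 = 1 := by simp [betaEV]

lemma betaEV_pos (k : ℕ) : 0 < betaEV k := by
  have : 0 < (2 * k).choose k := Nat.choose_pos (by omega)
  rw [betaEV]
  positivity

lemma betaEV_strictAnti : StrictAnti betaEV := by
  refine strictAnti_nat_of_succ_lt fun k => ?_
  have h : ((k : ℝ) + 1) * (k + 1).centralBinom = 2 * (2 * k + 1) * k.centralBinom := by
    exact_mod_cast Nat.succ_mul_centralBinom_succ k
  have hk : ((k : ℝ) + 1) ≠ 0 := by positivity
  have hlt : ((2 * (2 * k + 1) / (k + 1) : ℝ)) ^ 2 < 16 := by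
    rw [div_pow, div_lt_iff₀ (by positivity)]
    nlinarith [(Nat.cast_nonneg k : (0 : ℝ) ≤ k)]
  have hrec : betaEV (k + 1) = betaEV k * ((2 * (2 * k + 1) / (k + 1) : ℝ) ^ 2 / 16) := by
    rw [mul_comm, ← eq_div_iff hk] at h
    rw [betaEV, betaEV, ← Nat.centralBinom, ← Nat.centralBinom, h]
    field_simp
    ring
  rw [hrec]
  exact mul_lt_of_lt_one_right (betaEV_pos k) (by linarith)

lemma diagEntry_ne_betaEV {m k : ℕ} (h : m < 2 * k) : diagEntry m ≠ betaEV k := by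
  rw [diagEntry]
  split_ifs
  · exact betaEV_strictAnti.injective.ne (by omega)
  · exact (betaEV_pos k).ne

lemma choose_le_finrank_eigenspace (n k : ℕ) :
    n.choose (2 * k) ≤ Module.finrank ℝ ((KEndo n).eigenspace (betaEV k)) := by
  have : Nonempty (Icc 1 n).powerset := ⟨⟨∅, empty_mem_powerset _⟩⟩
  let b : Module.Basis (Icc 1 n).powerset ℝ ((Icc 1 n).powerset → ℝ) :=
    basisOfLinearIndependentOfCardEqFinrank (linearIndependent_upIndicator n) (by simp)
  have hb : ⇑b = upIndicator n := coe_basisOfLinearIndependentOfCardEqFinrank _ _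
  have hcard : #{S : (Icc 1 n).powerset | #S.1 = 2 * k} = n.choose (2 * k) := by
    rw [← Finset.card_map (Function.Embedding.subtype _)]
    trans #((Icc 1 n).powersetCard (2 * k))
    · congr 1
      ext T
      simp [mem_powersetCard, and_comm]
    · simp
  rw [← hcard]
  refine card_le_finrank_eigenspace_of_triangular (KEndo n) b (fun S => diagEntry #S.1) ?_ _ _ ?_
  · intro S
    rw [hb]
    exact KEndo_upIndicator_sub_mem n S
  · intro S hS
    have hS : #S.1 = 2 * k := (mem_filter.1 hS).2
    refine ⟨by simp [diagEntry, hS], fun T hT => diagEntry_ne_betaEV ?_⟩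
    rw [← hS]
    exact card_lt_card hT

lemma Kmat_sdiff_right {n : ℕ} {x y : Finset ℕ} (hx : x ⊆ Icc 1 n) (hy : y ⊆ Icc 1 n) :
    Kmat n x (Icc 1 n \ y) = Kmat n x y := by
  have h₁ : Icc 1 n \ (Icc 1 n \ y) = y := Finset.sdiff_sdiff_eq_self hy
  rw [Kmat_eq_arcsineWeight hx sdiff_subset, Kmat_eq_arcsineWeight hx hy, h₁,
    arcsineWeight_comm, arcsineWeight_comm #(y \ x)]

/-- Complementation on the state space. -/
noncomputable def complEquiv (n : ℕ) : Equiv.Perm (Icc 1 n).powerset where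
  toFun y := ⟨Icc 1 n \ y.1, mem_powerset.2 sdiff_subset⟩
  invFun y := ⟨Icc 1 n \ y.1, mem_powerset.2 sdiff_subset⟩
  left_inv y := Subtype.ext (Finset.sdiff_sdiff_eq_self (mem_powerset.1 y.2))
  right_inv y := Subtype.ext (Finset.sdiff_sdiff_eq_self (mem_powerset.1 y.2))

lemma KEndo_eq_zero_of_odd {n : ℕ} {f : (Icc 1 n).powerset → ℝ}
    (hf : ∀ y, f (complEquiv n y) = -f y) : KEndo n f = 0 := by
  ext x
  have h : KEndo n f x = -KEndo n f x := by
    calc KEndo n f x = ∑ y, Kmat n x.1 (complEquiv n y).1 * f (complEquiv n y) :=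
          (Equiv.sum_comp (complEquiv n) fun y => Kmat n x.1 y.1 * f y).symm
      _ = -KEndo n f x := by
          simp only [hf, mul_neg, Finset.sum_neg_distrib]
          refine congrArg _ (Finset.sum_congr rfl fun y _ => ?_)
          exact congrArg (· * f y)
            (Kmat_sdiff_right (mem_powerset.1 x.2) (mem_powerset.1 y.2))
  exact self_eq_neg.1 h

lemma two_pow_le_finrank_ker {n : ℕ} (hn : 1 ≤ n) :
    2 ^ (n - 1) ≤ Module.finrank ℝ (LinearMap.ker (KEndo n)) := by
  have hone : 1 ∈ Icc 1 n := mem_Icc.2 ⟨le_rfl, hn⟩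
  let e : ((Icc 1 n).erase 1).powerset → (Icc 1 n).powerset := fun y =>
    ⟨y.1, mem_powerset.2 ((mem_powerset.1 y.2).trans (erase_subset _ _))⟩
  let r (y : (Icc 1 n).powerset) : ((Icc 1 n).erase 1).powerset :=
    ⟨y.1.erase 1, mem_powerset.2 (erase_subset_erase _ (mem_powerset.1 y.2))⟩
  let φ : (((Icc 1 n).erase 1).powerset → ℝ) →ₗ[ℝ] ((Icc 1 n).powerset → ℝ) :=
    { toFun := fun g y => if 1 ∈ y.1 then -g (r (complEquiv n y)) else g (r y)
      map_add' := fun g g' => by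
        ext y
        by_cases hy : 1 ∈ y.1 <;> simp [hy, add_comm]
      map_smul' := fun c g => by
        ext y
        by_cases hy : 1 ∈ y.1 <;> simp [hy] }
  have hker : ∀ g, φ g ∈ LinearMap.ker (KEndo n) := by
    intro g
    refine KEndo_eq_zero_of_odd fun y => ?_
    have hinv : complEquiv n (complEquiv n y) = y := (complEquiv n).left_inv y
    have hmem : 1 ∈ (complEquiv n y).1 ↔ 1 ∉ y.1 := by simp [complEquiv, hn]
    by_cases hy : 1 ∈ y.1 <;> simp [φ, hmem, hy, hinv]
  have hinj : Function.Injective (φ.codRestrict _ hker) := by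
    intro g g' h
    ext y
    have h := congrFun (congrArg Subtype.val h) (e y)
    have hy : 1 ∉ y.1 := fun hy => notMem_erase 1 _ (mem_powerset.1 y.2 hy)
    have hr : r (e y) = y := Subtype.ext (erase_eq_of_notMem hy)
    have he : 1 ∉ (e y).1 := hy
    simpa [φ, he, hr] using h
  simpa [card_erase_of_mem hone] using LinearMap.finrank_le_finrank_of_injective hinj

lemma sum_choose_two_mul {n : ℕ} (hn : 1 ≤ n) :
    ∑ k ∈ range (n / 2 + 1), n.choose (2 * k) = 2 ^ (n - 1) := by
  obtain ⟨m, rfl⟩ : ∃ m, n = m + 1 := ⟨n - 1, by omega⟩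
  have key : ∀ N, ∑ k ∈ range (N + 1), (m + 1).choose (2 * k) =
      ∑ j ∈ range (2 * N + 1), m.choose j := by
    intro N
    induction N with
    | zero => simp
    | succ N ih =>
      rw [Finset.sum_range_succ, ih, show 2 * (N + 1) + 1 = 2 * N + 1 + 1 + 1 by ring,
        Finset.sum_range_succ _ (2 * N + 1 + 1), Finset.sum_range_succ _ (2 * N + 1),
        show 2 * (N + 1) = 2 * N + 1 + 1 by ring, Nat.choose_succ_succ, add_assoc]
  rw [key, Nat.add_sub_cancel, ← Nat.sum_range_choose m]
  refine (Finset.sum_subset (by simp; omega) fun j _ hj => ?_).symm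
  rw [mem_range] at hj
  exact Nat.choose_eq_zero_of_lt (by omega)

lemma sum_finrank_le_of_iSupIndep {ι 𝕜 V : Type*} [Fintype ι] [Field 𝕜] [AddCommGroup V]
    [Module 𝕜 V] [FiniteDimensional 𝕜 V] {p : ι → Submodule 𝕜 V} (hp : iSupIndep p) :
    ∑ i, Module.finrank 𝕜 (p i) ≤ Module.finrank 𝕜 V := by
  rw [← Module.finrank_directSum]
  exact LinearMap.finrank_le_finrank_of_injective hp.dfinsupp_lsum_injective

lemma finrank_ker_add_sum_finrank_eigenspace_le (n : ℕ) :
    Module.finrank ℝ (LinearMap.ker (KEndo n)) + ∑ k ∈ range (n / 2 + 1),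
      Module.finrank ℝ ((KEndo n).eigenspace (betaEV k)) ≤ 2 ^ n := by
  let μ : Option (Fin (n / 2 + 1)) → ℝ := fun o => o.elim 0 fun k => betaEV k
  have hμ : Function.Injective μ := by
    rintro (_ | k) (_ | l) h
    · rfl
    · exact absurd h (betaEV_pos l).ne
    · exact absurd h (betaEV_pos k).ne'
    · exact congrArg some (Fin.ext (betaEV_strictAnti.injective h))
  have h := sum_finrank_le_of_iSupIndep ((KEndo n).eigenspaces_iSupIndep.comp hμ)
  rw [Fintype.sum_option, Module.finrank_fintype_fun_eq_card, Fintype.card_coe, card_powerset,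
    Nat.card_Icc, Nat.add_sub_cancel] at h
  rw [Finset.sum_range, ← Module.End.eigenspace_zero]
  exact h

/-- the eigenspace of K_n for eigenvalue 1 has dimension 1, the eigenspace
for β_k = C(2k,k)²/16^k has dimension C(n,2k) for 1 ≤ k ≤ ⌊n/2⌋, and the kernel has
dimension 2^{n−1}. -/
theorem KEndo_eigenspace_dims (n : ℕ) (hn : 1 ≤ n) :
    Module.finrank ℝ (Module.End.eigenspace (KEndo n) 1) = 1 ∧
    (∀ k, 1 ≤ k → 2 * k ≤ n →
      Module.finrank ℝ (Module.End.eigenspace (KEndo n) (betaEV k)) = n.choose (2 * k)) ∧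
    Module.finrank ℝ (LinearMap.ker (KEndo n)) = 2 ^ (n - 1) := by
  have hsum := finrank_ker_add_sum_finrank_eigenspace_le n
  have hk := two_pow_le_finrank_ker hn
  have hpow : 2 ^ n = 2 ^ (n - 1) + 2 ^ (n - 1) := by
    rw [← two_mul, ← pow_succ', Nat.sub_add_cancel hn]
  have hchoose := sum_choose_two_mul hn
  have hle := Finset.sum_le_sum fun k (_ : k ∈ range (n / 2 + 1)) => choose_le_finrank_eigenspace n k
  have heq := (Finset.sum_eq_sum_iff_of_le fun k (_ : k ∈ range (n / 2 + 1)) =>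
    choose_le_finrank_eigenspace n k).1 (by omega)
  refine ⟨?_, fun k _ hkn => (heq k (mem_range.2 (by omega))).symm, by omega⟩
  rw [← betaEV_zero, ← heq 0 (by simp)]
  simp
end
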